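/- arXiv:0707.3373 — 6 statements merged into one kernel-verified Lean document; each statement's English description precedes it below -/
import Mathlib

section
/- Let k, s ≥ 1 and let S^{k,s} be the circular sequence of length ks indexed by ℤ/(ks)ℤ with labeling f : ℤ/(ks)ℤ → {1,…,k} given by f(i) = (i mod k) + 1 (that is, s successive blocks of the form 1,2,…,k). If A ⊆ ℤ/(ks)ℤ is a set of positions that contains no cyclic xyxy-pattern with respect to f, then |A| < k + s. -/
/-- A set of integers in `[l, u)` in which no two residue classes modulo `k` cross has at most
`(u - l - 1) / k` more elements than residues. -/
theorem card_mul_add_lt_of_noncrossing (k : ℕ) (A : Finset ℕ) (l u : ℕ) (hlu : l < u)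
    (hb : ∀ i ∈ A, l ≤ i ∧ i < u)
    (hA : ∀ a ∈ A, ∀ b ∈ A, ∀ c ∈ A, ∀ d ∈ A, a < b → b < c → c < d →
      a % k = c % k → b % k = d % k → a % k = b % k) :
    A.card * k + l < (A.image (· % k)).card * k + u := by
  induction A using Finset.strongInduction generalizing l u with
  | H A ih =>
    rcases A.eq_empty_or_nonempty with rfl | hne
    · simpa using hlu
    set a := A.min' hne
    have haA : a ∈ A := A.min'_mem hne
    have ha_le : ∀ i ∈ A, a ≤ i := fun i hi => A.min'_le i hi
    have ha := hb a haA
    by_cases hrep : (A.filter (fun i => a < i ∧ i % k = a % k)).Nonempty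
    · set c := (A.filter (fun i => a < i ∧ i % k = a % k)).min' hrep
      obtain ⟨hcA, hac, hck⟩ : c ∈ A ∧ a < c ∧ c % k = a % k :=
        Finset.mem_filter.1 (Finset.min'_mem _ hrep)
      have hc_le : ∀ i ∈ A, a < i → i % k = a % k → c ≤ i := fun i hi h₁ h₂ =>
        Finset.min'_le _ i (by simp [hi, h₁, h₂])
      set I := A.filter (fun i => a < i ∧ i < c) with hI
      set R := A.filter (fun i => c ≤ i) with hR
      have hIA : I ⊆ A := Finset.filter_subset _ _
      have hRA : R ⊆ A := Finset.filter_subset _ _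
      have haI : a ∉ I := by simp [hI]
      have haR : a ∉ R := by simp [hR, hac]
      have hIlt := ih I ((Finset.ssubset_iff_of_subset hIA).2 ⟨a, haA, haI⟩) a c hac
        (fun i hi => by simp only [hI, Finset.mem_filter] at hi; omega)
        (fun p hp q hq r hr t ht => hA p (hIA hp) q (hIA hq) r (hIA hr) t (hIA ht))
      have hRlt := ih R ((Finset.ssubset_iff_of_subset hRA).2 ⟨a, haA, haR⟩) c u (hb c hcA).2
        (fun i hi => ⟨(Finset.mem_filter.1 hi).2, (hb i (hRA hi)).2⟩)
        (fun p hp q hq r hr t ht => hA p (hRA hp) q (hRA hq) r (hRA hr) t (hRA ht))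
      have hIR : Disjoint I R := by
        rw [Finset.disjoint_left]
        intro i hi hj
        simp only [hI, hR, Finset.mem_filter] at hi hj
        omega
      have hunion : A = insert a (I ∪ R) := by
        ext i
        simp only [hI, hR, Finset.mem_insert, Finset.mem_union, Finset.mem_filter]
        have := ha_le i
        grind
      have hcard : A.card = I.card + R.card + 1 := by
        conv_lhs => rw [hunion]
        rw [Finset.card_insert_of_notMem (by simp [haI, haR]), Finset.card_union_of_disjoint hIR]
      have hdisj : Disjoint (I.image (· % k)) (R.image (· % k)) := by
        rw [Finset.disjoint_left]
        intro x hx hy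
        obtain ⟨i, hi, rfl⟩ := Finset.mem_image.1 hx
        obtain ⟨j, hj, hji⟩ := Finset.mem_image.1 hy
        simp only [hI, hR, Finset.mem_filter] at hi hj
        have hia : i % k ≠ a % k := fun h => by
          have := hc_le i hi.1 hi.2.1 h
          omega
        have hcj : c ≠ j := by
          rintro h
          exact hia (by rw [← hji, ← h, hck])
        exact hia (hA a haA i hi.1 c hcA j hj.1 hi.2.1 hi.2.2 (by omega) hck.symm hji.symm).symm
      have himg : (I.image (· % k)).card + (R.image (· % k)).card ≤ (A.image (· % k)).card := by
        rw [← Finset.card_union_of_disjoint hdisj]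
        exact Finset.card_le_card
          (Finset.union_subset (Finset.image_subset_image hIA) (Finset.image_subset_image hRA))
      obtain ⟨m, hm⟩ : k ∣ c - a := (Nat.modEq_iff_dvd' hac.le).1 hck.symm
      have hIm : I.card + 1 ≤ (I.image (· % k)).card + m := by
        by_contra! h
        have := Nat.mul_le_mul_right k (Nat.le_of_lt_succ h)
        nlinarith [Nat.sub_add_cancel hac.le]
      have hgap : c = a + k * m := by omega
      have h₁ := Nat.mul_le_mul_right k hIm
      have h₂ := Nat.mul_le_mul_right k himg
      rw [hcard]
      nlinarith
    · have hlt := ih (A.erase a) (Finset.erase_ssubset haA) l u hlu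
        (fun i hi => hb i (Finset.mem_of_mem_erase hi))
        (fun p hp q hq r hr t ht => hA p (Finset.mem_of_mem_erase hp) q
          (Finset.mem_of_mem_erase hq) r (Finset.mem_of_mem_erase hr) t
          (Finset.mem_of_mem_erase ht))
      have hnot : a % k ∉ (A.erase a).image (· % k) := by
        intro h
        obtain ⟨i, hi, hik⟩ := Finset.mem_image.1 h
        obtain ⟨hia, hiA⟩ := Finset.mem_erase.1 hi
        exact hrep ⟨i, Finset.mem_filter.2 ⟨hiA, lt_of_le_of_ne (ha_le i hiA) hia.symm, hik⟩⟩
      have himg : (A.image (· % k)).card = ((A.erase a).image (· % k)).card + 1 := by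
        conv_lhs => rw [← Finset.insert_erase haA, Finset.image_insert]
        exact Finset.card_insert_of_notMem hnot
      rw [himg, ← Finset.card_erase_add_one haA]
      linarith


/-- Lemma 1 (circular sequence lemma): if `A ⊆ ℤ/(ks)ℤ` avoids a cyclic
`xyxy`-pattern with respect to the labeling `f i = (i mod k) + 1`
(i.e. `s` successive blocks `1,2,…,k`), then `|A| < k + s`. -/
theorem circular_sequence_lemma (k s : ℕ) (hk : 1 ≤ k) (hs : 1 ≤ s)
    (f : ZMod (k * s) → ℕ)
    (hf : ∀ i : ZMod (k * s), f i = i.val % k + 1)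
    (A : Finset (ZMod (k * s)))
    (hA : ¬ ∃ a ∈ A, ∃ b ∈ A, ∃ c ∈ A, ∃ d ∈ A, ∃ r : ZMod (k * s),
      (a - r).val < (b - r).val ∧ (b - r).val < (c - r).val ∧ (c - r).val < (d - r).val ∧
      f a = f c ∧ f b = f d ∧ f a ≠ f b) :
    A.card < k + s := by
  have hks : 0 < k * s := Nat.mul_pos hk hs
  have : NeZero (k * s) := ⟨hks.ne'⟩
  have hlt := card_mul_add_lt_of_noncrossing k (A.image ZMod.val) 0 (k * s) hks
    (by
      intro i hi
      obtain ⟨x, -, rfl⟩ := Finset.mem_image.1 hi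
      exact ⟨Nat.zero_le _, x.val_lt⟩)
    (by
      simp only [Finset.forall_mem_image]
      intro a ha b hb c hc d hd hab hbc hcd hac hbd
      by_contra hne
      exact hA ⟨a, ha, b, hb, c, hc, d, hd, 0, by simpa using hab, by simpa using hbc,
        by simpa using hcd, by simp [hf, hac], by simp [hf, hbd], by simpa [hf] using hne⟩)
  rw [Finset.card_image_of_injective _ (ZMod.val_injective _)] at hlt
  have himg : ((A.image ZMod.val).image (· % k)).card ≤ k := by
    simpa using Finset.card_le_card (t := Finset.range k) (fun x hx => by
      obtain ⟨i, -, rfl⟩ := Finset.mem_image.1 hx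
      exact Finset.mem_range.2 (Nat.mod_lt _ hk))
  have hmul := Nat.mul_le_mul_right k himg
  refine Nat.lt_of_mul_lt_mul_right (a := k) ?_
  linarith
end

section
/- Let k, s ≥ 1 and let f : Fin(ks) → Fin k be the labeling f(i) = i mod k (the linear sequence consisting of s consecutive blocks 0,1,…,k−1). Suppose A ⊆ Fin(ks) is a set of positions such that there do not exist positions a < b < c < d, all in A, with f(a) = f(c), f(b) = f(d), and f(a) ≠ f(b). Then |A| ≤ k + s − 1. -/
/-- A finite set of naturals is noncrossing modulo `k` if its sequence of residues has no
subsequence `x, y, x, y` with `x ≠ y`. -/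
def NoncrossingMod (k : ℕ) (A : Finset ℕ) : Prop :=
  ∀ a ∈ A, ∀ b ∈ A, ∀ c ∈ A, ∀ d ∈ A,
    a < b → b < c → c < d → a % k = c % k → b % k = d % k → a % k = b % k

theorem NoncrossingMod.mono {k : ℕ} {A B : Finset ℕ} (hB : NoncrossingMod k B) (h : A ⊆ B) :
    NoncrossingMod k A :=
  fun a ha b hb c hc d hd => hB a (h ha) b (h hb) c (h hc) d (h hd)

theorem NoncrossingMod.card_le {k : ℕ} (hk : 0 < k) (A : Finset ℕ) (l r : ℕ)
    (hlr : A ⊆ Finset.Icc l r) (hA : NoncrossingMod k A) :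
    A.card ≤ (A.image (· % k)).card + (r - l) / k := by
  induction A using Finset.strongInduction generalizing l r with
  | H A ih =>
  rcases A.eq_empty_or_nonempty with rfl | hne
  · simp
  obtain ⟨a, ha, hmin⟩ : ∃ a ∈ A, ∀ x ∈ A, a ≤ x := A.exists_min_image id hne
  have hbounds : ∀ x ∈ A, l ≤ x ∧ x ≤ r := fun x hx => Finset.mem_Icc.1 (hlr hx)
  by_cases hrep : (A.filter fun x => a < x ∧ x % k = a % k).Nonempty
  · obtain ⟨b, hb, hbmin⟩ := Finset.exists_min_image _ id hrep
    simp only [Finset.mem_filter, id] at hb hbmin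
    obtain ⟨hbA, hab, hbmod⟩ := hb
    set B := A.filter fun x => a < x ∧ x < b with hB
    set C := A.filter fun x => b ≤ x with hC
    have hBA : B ⊆ A := Finset.filter_subset _ _
    have hCA : C ⊆ A := Finset.filter_subset _ _
    have haB : a ∉ B := by simp [hB]
    have haC : a ∉ C := by simp [hC, hab]
    have hBcard := ih B ((Finset.ssubset_iff_of_subset hBA).2 ⟨a, ha, haB⟩) a (b - 1)
      (fun x hx => by simp only [hB, Finset.mem_filter] at hx; simp only [Finset.mem_Icc]; omega)
      (hA.mono hBA)
    have hCcard := ih C ((Finset.ssubset_iff_of_subset hCA).2 ⟨a, ha, haC⟩) b r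
      (fun x hx => by
        simp only [hC, Finset.mem_filter] at hx
        exact Finset.mem_Icc.2 ⟨hx.2, (hbounds x hx.1).2⟩)
      (hA.mono hCA)
    have hsplit : A ⊆ insert a (B ∪ C) := fun x hx => by
      have := hmin x hx
      simp only [hB, hC, Finset.mem_insert, Finset.mem_union, Finset.mem_filter, hx, true_and]
      omega
    have hcard : A.card ≤ B.card + C.card + 1 :=
      (Finset.card_le_card hsplit).trans <| (Finset.card_insert_le _ _).trans <|
        Nat.add_le_add_right (Finset.card_union_le _ _) 1
    have hdisj : Disjoint (B.image (· % k)) (C.image (· % k)) := by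
      rw [Finset.disjoint_left]
      intro y hyB hyC
      obtain ⟨u, hu, rfl⟩ := Finset.mem_image.1 hyB
      obtain ⟨v, hv, huv⟩ := Finset.mem_image.1 hyC
      simp only [hB, hC, Finset.mem_filter] at hu hv
      obtain ⟨hu, hau, hub⟩ := hu
      have hne : u % k ≠ a % k := fun h => absurd (hbmin u ⟨hu, hau, h⟩) (by omega)
      have hvb : b ≠ v := by
        rintro rfl
        exact hne (huv.symm.trans hbmod)
      exact hne (hA a ha u hu b hbA v hv.1 hau hub (lt_of_le_of_ne hv.2 hvb)
        hbmod.symm huv.symm).symm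
    have himage : (B.image (· % k)).card + (C.image (· % k)).card
        ≤ (A.image (· % k)).card := by
      rw [← Finset.card_union_of_disjoint hdisj]
      exact Finset.card_le_card
        (Finset.union_subset (Finset.image_subset_image hBA) (Finset.image_subset_image hCA))
    obtain ⟨m, hm⟩ : k ∣ b - a := (Nat.modEq_iff_dvd' hab.le).1 hbmod.symm
    have hgap : (b - 1 - a) / k + 1 ≤ m :=
      Nat.div_lt_of_lt_mul (by omega)
    have hdiv : m + (r - b) / k ≤ (r - l) / k := by
      rw [← Nat.mul_add_div hk]
      apply Nat.div_le_div_right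
      have := hbounds a ha
      have := hbounds b hbA
      omega
    omega
  · have hlt := Finset.erase_ssubset ha
    have hcard := ih (A.erase a) hlt l r (hlt.subset.trans hlr) (hA.mono hlt.subset)
    have hnot : a % k ∉ (A.erase a).image (· % k) := by
      intro h
      obtain ⟨x, hx, hxa⟩ := Finset.mem_image.1 h
      obtain ⟨hxne, hxA⟩ := Finset.mem_erase.1 hx
      exact hrep ⟨x, Finset.mem_filter.2
        ⟨hxA, lt_of_le_of_ne (hmin x hxA) hxne.symm, hxa⟩⟩
    rw [← Finset.insert_erase ha, Finset.image_insert, Finset.card_insert_of_notMem hnot,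
      Finset.card_insert_of_notMem (Finset.notMem_erase a A)]
    omega

/-- Linear form of the sequence bound: a subsequence of `s` consecutive blocks
`0,1,…,k−1` avoiding any (not necessarily contiguous) subsequence `x,y,x,y`
with `x ≠ y` has length at most `k + s − 1`. -/
theorem linear_sequence_lemma (k s : ℕ) (hk : 1 ≤ k) (hs : 1 ≤ s)
    (f : Fin (k * s) → Fin k)
    (hf : ∀ i : Fin (k * s), (f i : ℕ) = i.val % k)
    (A : Finset (Fin (k * s)))
    (hA : ¬ ∃ a ∈ A, ∃ b ∈ A, ∃ c ∈ A, ∃ d ∈ A,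
      a < b ∧ b < c ∧ c < d ∧ f a = f c ∧ f b = f d ∧ f a ≠ f b) :
    A.card ≤ k + s - 1 := by
  have hnc : NoncrossingMod k (A.map Fin.valEmbedding) := by
    intro a ha b hb c hc d hd hab hbc hcd hac hbd
    obtain ⟨a, haA, rfl⟩ := Finset.mem_map.1 ha
    obtain ⟨b, hbA, rfl⟩ := Finset.mem_map.1 hb
    obtain ⟨c, hcA, rfl⟩ := Finset.mem_map.1 hc
    obtain ⟨d, hdA, rfl⟩ := Finset.mem_map.1 hd
    simp only [Fin.valEmbedding_apply, ← hf] at hac hbd ⊢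
    by_contra h
    exact hA ⟨a, haA, b, hbA, c, hcA, d, hdA, hab, hbc, hcd, Fin.ext hac, Fin.ext hbd,
      fun h' => h (congrArg Fin.val h')⟩
  have hcard := hnc.card_le hk _ 0 (k * s - 1) fun x hx => by
    obtain ⟨i, -, rfl⟩ := Finset.mem_map.1 hx
    have := i.isLt
    simp only [Fin.valEmbedding_apply, Finset.mem_Icc]
    omega
  have himage : ((A.map Fin.valEmbedding).image (· % k)).card ≤ k := by
    refine (Finset.card_le_card fun y hy => ?_).trans (Finset.card_range k).le
    obtain ⟨x, -, rfl⟩ := Finset.mem_image.1 hy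
    exact Finset.mem_range.2 (Nat.mod_lt _ hk)
  have hdiv : (k * s - 1 - 0) / k < s :=
    Nat.div_lt_of_lt_mul (by have := Nat.mul_pos hk hs; omega)
  rw [Finset.card_map] at hcard
  omega
end

section
/- Let k ≥ 2, let o ∈ ℝ², r > 0, and let I be a finite index set. For each i ∈ I, let θ_i ∈ ℝ and let P_i = { o + r·(cos(θ_i + 2πj/k), sin(θ_i + 2πj/k)) : j = 0, 1, …, k−1 } be the vertex set of a regular k-gon inscribed in the circle of center o and radius r. Suppose (T_i)_{i ∈ I} is a family of pairwise disjoint convex subsets of ℝ² such that |T_i ∩ P_i| ≥ 2 for every i ∈ I. Then |I| ≤ k − 1. -/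
open Real in
theorem sin_sub_add_sin_sub_add_sin_sub_pos {x y z : ℝ} (hxy : x < y) (hyz : y < z)
    (hzx : z < x + 2 * π) : 0 < sin (y - x) + sin (z - y) + sin (x - z) := by
  have key : sin (y - x) + sin (z - y) + sin (x - z) =
      4 * sin ((y - x) / 2) * sin ((z - y) / 2) * sin ((z - x) / 2) := by
    have h₁ : y - x = 2 * ((y - x) / 2) := by ring
    have h₂ : z - y = 2 * ((z - y) / 2) := by ring
    have h₃ : x - z = -(2 * ((y - x) / 2) + 2 * ((z - y) / 2)) := by ring
    have h₄ : (z - x) / 2 = (y - x) / 2 + (z - y) / 2 := by ring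
    rw [h₃, h₄, sin_neg]
    generalize (y - x) / 2 = a at *
    generalize (z - y) / 2 = b at *
    rw [h₁, h₂, sin_add, sin_add, sin_two_mul, sin_two_mul, cos_two_mul, cos_two_mul]
    linear_combination (-4 * sin a * cos a) * sin_sq_add_cos_sq b +
      (-4 * sin b * cos b) * sin_sq_add_cos_sq a
  rw [key]
  have h₁ := sin_pos_of_pos_of_lt_pi (x := (y - x) / 2) (by linarith) (by linarith)
  have h₂ := sin_pos_of_pos_of_lt_pi (x := (z - y) / 2) (by linarith) (by linarith)
  have h₃ := sin_pos_of_pos_of_lt_pi (x := (z - x) / 2) (by linarith) (by linarith)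
  positivity

/-- The point at angle `t` on the circle with center `o` and radius `r`. -/
noncomputable def circlePoint (o : ℝ × ℝ) (r t : ℝ) : ℝ × ℝ :=
  o + r • (Real.cos t, Real.sin t)

theorem circlePoint_add_int_mul_two_pi (o : ℝ × ℝ) (r t : ℝ) (n : ℤ) :
    circlePoint o r (t + n * (2 * Real.pi)) = circlePoint o r t := by
  simp [circlePoint, Real.cos_add_int_mul_two_pi, Real.sin_add_int_mul_two_pi]

/-- Convex sets containing two crossing chords of a circle intersect. -/
theorem Convex.not_disjoint_of_circlePoint_mem {o : ℝ × ℝ} {r : ℝ} {S T : Set (ℝ × ℝ)}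
    (hS : Convex ℝ S) (hT : Convex ℝ T) {α β γ δ : ℝ} (hαβ : α ≤ β) (hβγ : β ≤ γ) (hγδ : γ ≤ δ)
    (hδα : δ < α + 2 * Real.pi) (hα : circlePoint o r α ∈ S) (hγ : circlePoint o r γ ∈ S)
    (hβ : circlePoint o r β ∈ T) (hδ : circlePoint o r δ ∈ T) : ¬ Disjoint S T := by
  rw [Set.not_disjoint_iff]
  rcases hαβ.eq_or_lt with rfl | hαβ
  · exact ⟨_, hα, hβ⟩
  rcases hβγ.eq_or_lt with rfl | hβγ
  · exact ⟨_, hγ, hβ⟩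
  rcases hγδ.eq_or_lt with rfl | hγδ
  · exact ⟨_, hγ, hδ⟩
  have h₁ := sin_sub_add_sin_sub_add_sin_sub_pos hβγ hγδ (by linarith)
  have h₂ := sin_sub_add_sin_sub_add_sin_sub_pos (hαβ.trans hβγ) hγδ hδα
  have h₃ := sin_sub_add_sin_sub_add_sin_sub_pos hαβ (hβγ.trans hγδ) hδα
  have h₄ := sin_sub_add_sin_sub_add_sin_sub_pos hαβ hβγ (by linarith)
  set A := Real.sin (γ - β) + Real.sin (δ - γ) + Real.sin (β - δ) with hA
  set B := Real.sin (γ - α) + Real.sin (δ - γ) + Real.sin (α - δ) with hB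
  set C := Real.sin (β - α) + Real.sin (δ - β) + Real.sin (α - δ) with hC
  set D := Real.sin (β - α) + Real.sin (γ - β) + Real.sin (α - γ) with hD
  have hsum : A + C = B + D := by
    rw [hA, hB, hC, hD, ← neg_sub δ β, ← neg_sub γ α, Real.sin_neg, Real.sin_neg]
    ring
  have hcos : A * Real.cos α + C * Real.cos γ = B * Real.cos β + D * Real.cos δ := by
    simp only [hA, hB, hC, hD, Real.sin_sub]
    ring
  have hsin : A * Real.sin α + C * Real.sin γ = B * Real.sin β + D * Real.sin δ := by
    simp only [hA, hB, hC, hD, Real.sin_sub]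
    ring
  have hAC : 0 < A + C := by positivity
  refine ⟨_, hS hα hγ (a := A / (A + C)) (b := C / (A + C)) (by positivity) (by positivity)
    (by field_simp), ?_⟩
  convert hT hβ hδ (a := B / (A + C)) (b := D / (A + C)) (by positivity) (by positivity)
    (by rw [← add_div, ← hsum, div_self hAC.ne']) using 1
  clear_value A B C D
  ext
  · simp only [circlePoint, Prod.fst_add, Prod.smul_fst, smul_eq_mul]
    field_simp
    linear_combination o.1 * hsum + r * hcos
  · simp only [circlePoint, Prod.snd_add, Prod.smul_snd, smul_eq_mul]
    field_simp
    linear_combination o.2 * hsum + r * hsin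

/-- A noncrossing family of closed intervals of positive integer length, contained in a half-open
interval `[x, y)`, has fewer than `y - x` members. -/
theorem Finset.card_lt_sub_of_noncrossing {ι : Type*} (a b : ι → ℝ) (S : Finset ι) {x y : ℝ}
    (hxy : x < y) (hx : ∀ i ∈ S, x ≤ a i) (hab : ∀ i ∈ S, a i < b i) (hy : ∀ i ∈ S, b i < y)
    (hint : ∀ i ∈ S, ∃ m : ℕ, b i - a i = m)
    (hcross : ∀ i ∈ S, ∀ j ∈ S, i ≠ j → a i ≤ a j → b i < a j ∨ b j < b i) :
    (S.card : ℝ) < y - x := by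
  classical
  induction S using Finset.strongInduction generalizing x y with
  | H S ih =>
    rcases S.eq_empty_or_nonempty with rfl | hne
    · simpa using hxy
    obtain ⟨i, hi, hmin⟩ := S.exists_min_image a hne
    set U := (S.erase i).filter (fun j => b j < b i) with hU
    set V := (S.erase i).filter (fun j => ¬ b j < b i) with hV
    have hcard : U.card + V.card + 1 = S.card := by
      rw [hU, hV, Finset.card_filter_add_card_filter_not, Finset.card_erase_add_one hi]
    have hUS : U ⊂ S := (Finset.filter_subset _ _).trans_ssubset (Finset.erase_ssubset hi)
    have hVS : V ⊂ S := (Finset.filter_subset _ _).trans_ssubset (Finset.erase_ssubset hi)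
    have hU' := ih U hUS (hab i hi) (fun j hj => hmin j (hUS.1 hj)) (fun j hj => hab j (hUS.1 hj))
      (fun j hj => (Finset.mem_filter.1 hj).2) (fun j hj => hint j (hUS.1 hj))
      (fun j hj l hl => hcross j (hUS.1 hj) l (hUS.1 hl))
    have hV' := ih V hVS (hy i hi)
      (fun j hj => by
        obtain ⟨hj', hbj⟩ := Finset.mem_filter.1 hj
        obtain ⟨hji, hjS⟩ := Finset.mem_erase.1 hj'
        exact ((hcross i hi j hjS hji.symm (hmin j hjS)).resolve_right hbj).le)
      (fun j hj => hab j (hVS.1 hj)) (fun j hj => hy j (hVS.1 hj))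
      (fun j hj => hint j (hVS.1 hj))
      (fun j hj l hl => hcross j (hVS.1 hj) l (hVS.1 hl))
    obtain ⟨m, hm⟩ := hint i hi
    rw [hm, Nat.cast_lt] at hU'
    have hUm : (U.card : ℝ) + 1 ≤ m := by exact_mod_cast hU'
    have hS : (S.card : ℝ) = U.card + V.card + 1 := by exact_mod_cast hcard.symm
    linarith [hx i hi]

/-- Two distinct vertices of a regular `k`-gon have angles of the form `2πa/k` and `2πb/k` with
`0 ≤ a < b < k` and `b - a` an integer. -/
theorem exists_angles_of_regular_polygon {k : ℕ} (hk : 0 < k) {o : ℝ × ℝ} {r θ : ℝ} {j l : ℕ}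
    (hne : circlePoint o r (θ + 2 * Real.pi * j / k) ≠ circlePoint o r (θ + 2 * Real.pi * l / k))
    {T : Set (ℝ × ℝ)} (hj : circlePoint o r (θ + 2 * Real.pi * j / k) ∈ T)
    (hl : circlePoint o r (θ + 2 * Real.pi * l / k) ∈ T) :
    ∃ a b : ℝ, 0 ≤ a ∧ a < b ∧ b < k ∧ (∃ m : ℕ, b - a = m) ∧
      circlePoint o r (2 * Real.pi / k * a) ∈ T ∧ circlePoint o r (2 * Real.pi / k * b) ∈ T := by
  have hk' : (0 : ℝ) < k := by exact_mod_cast hk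
  have hpi := Real.pi_pos
  set u : ℕ → ℝ := fun j => k * Int.fract (θ / (2 * Real.pi) + j / k) with hu
  have hpt (j : ℕ) : circlePoint o r (θ + 2 * Real.pi * j / k) =
      circlePoint o r (2 * Real.pi / k * u j) := by
    rw [← circlePoint_add_int_mul_two_pi o r (2 * Real.pi / k * u j)
      ⌊θ / (2 * Real.pi) + j / k⌋]
    congr 1
    simp only [hu, Int.fract]
    field_simp
    ring
  have hint (j l : ℕ) : ∃ n : ℤ, u l - u j = n := by
    refine ⟨l - j - k * (⌊θ / (2 * Real.pi) + l / k⌋ - ⌊θ / (2 * Real.pi) + j / k⌋), ?_⟩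
    push_cast
    simp only [hu, Int.fract]
    field_simp
    ring
  have hnat (j l : ℕ) (h : u j < u l) : ∃ m : ℕ, u l - u j = m := by
    obtain ⟨n, hn⟩ := hint j l
    have hn0 : 0 ≤ n := by
      have : (0 : ℝ) < n := by linarith
      exact_mod_cast this.le
    lift n to ℕ using hn0
    exact ⟨n, by exact_mod_cast hn⟩
  have h0 (j : ℕ) : 0 ≤ u j := mul_nonneg hk'.le (Int.fract_nonneg _)
  have h1 (j : ℕ) : u j < k := mul_lt_of_lt_one_right hk' (Int.fract_lt_one _)
  rw [hpt j, hpt l] at hne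
  rw [hpt] at hj hl
  have hujl : u j ≠ u l := fun h => hne (by rw [h])
  rcases hujl.lt_or_gt with h | h
  · exact ⟨u j, u l, h0 j, h, h1 l, hnat j l h, hj, hl⟩
  · exact ⟨u l, u j, h0 l, h, h1 j, hnat l j h, hl, hj⟩


/-- If pairwise disjoint convex regions `T i` each contain at least two vertices
of their own regular `k`-gon `P i` inscribed in a common circle, then there are
at most `k − 1` such regions. -/
theorem persistent_sets_bound {ι : Type*} (k : ℕ) (hk : 2 ≤ k)
    (o : ℝ × ℝ) (r : ℝ) (hr : 0 < r)
    (I : Finset ι) (θ : ι → ℝ)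
    (P : ι → Set (ℝ × ℝ))
    (hP : ∀ i, P i = {p : ℝ × ℝ | ∃ j < k,
      p = o + r • (Real.cos (θ i + 2 * Real.pi * (j : ℝ) / (k : ℝ)),
                   Real.sin (θ i + 2 * Real.pi * (j : ℝ) / (k : ℝ)))})
    (T : ι → Set (ℝ × ℝ))
    (hconv : ∀ i ∈ I, Convex ℝ (T i))
    (hdisj : (I : Set ι).Pairwise (Function.onFun Disjoint T))
    (hcard : ∀ i ∈ I, 2 ≤ (T i ∩ P i).ncard) :
    I.card ≤ k - 1 := by
  have hk' : (0 : ℝ) < k := by exact_mod_cast (by omega : 0 < k)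
  have hex (i : ι) : ∃ a b : ℝ, i ∈ I → 0 ≤ a ∧ a < b ∧ b < k ∧ (∃ m : ℕ, b - a = m) ∧
      circlePoint o r (2 * Real.pi / k * a) ∈ T i ∧
      circlePoint o r (2 * Real.pi / k * b) ∈ T i := by
    by_cases hi : i ∈ I
    · obtain ⟨p, q, ⟨hpT, hpP⟩, ⟨hqT, hqP⟩, hpq⟩ :=
        (Set.one_lt_ncard_iff (Set.finite_of_ncard_pos (by linarith [hcard i hi]))).1 (hcard i hi)
      rw [hP] at hpP hqP
      obtain ⟨j, -, rfl⟩ := hpP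
      obtain ⟨l, -, rfl⟩ := hqP
      obtain ⟨a, b, h⟩ := exists_angles_of_regular_polygon (by omega) hpq hpT hqT
      exact ⟨a, b, fun _ => h⟩
    · exact ⟨0, 0, fun h => absurd h hi⟩
  choose a b hab using hex
  have hlt : (I.card : ℝ) < k - 0 := by
    refine Finset.card_lt_sub_of_noncrossing a b I hk' (fun i hi => (hab i hi).1)
      (fun i hi => (hab i hi).2.1) (fun i hi => (hab i hi).2.2.1)
      (fun i hi => (hab i hi).2.2.2.1) fun i hi j hj hij haij => ?_
    by_contra! h
    obtain ⟨hai, -, -, -, hpi, hqi⟩ := hab i hi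
    obtain ⟨-, -, hbj, -, hpj, hqj⟩ := hab j hj
    have hc : 0 < 2 * Real.pi / k := by positivity
    refine (hconv i hi).not_disjoint_of_circlePoint_mem (hconv j hj)
      (mul_le_mul_of_nonneg_left haij hc.le) (mul_le_mul_of_nonneg_left h.1 hc.le)
      (mul_le_mul_of_nonneg_left h.2 hc.le) ?_ hpi hqi hpj hqj (hdisj hi hj hij)
    have h₁ : 2 * Real.pi / k * b j < 2 * Real.pi / k * k := mul_lt_mul_of_pos_left hbj hc
    rw [div_mul_cancel₀ _ hk'.ne'] at h₁
    have h₂ : 0 ≤ 2 * Real.pi / k * a i := mul_nonneg hc.le hai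
    linarith
  rw [sub_zero, Nat.cast_lt] at hlt
  omega
end

section
/- Let k ≥ 1 and n = k². Let x₀, x₁, …, x_{n−1} be n distinct points in cyclic order on a circle Γ ⊆ ℝ² with center o and radius r > 0, and label the point x_j with j mod k. Let T₀, T₁, …, T_{k−1} be pairwise disjoint convex subsets of ℝ², and for each i ∈ {0,…,k−1} let A_i ⊆ { x_j : j ≡ i (mod k) } ∩ T_i. Then |A₀| + |A₁| + ⋯ + |A_{k−1}| < 2k. -/
/-- A set of naturals whose residue classes mod `k` are pairwise non-crossing and which lies in
`[a, b]` exceeds its number of residue classes by at most `(b - a) / k`. -/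
theorem mul_card_add_le_of_noncrossing (k : ℕ) (S : Finset ℕ) (hS : S.Nonempty)
    (hnc : ∀ p ∈ S, ∀ q ∈ S, ∀ s ∈ S, ∀ t ∈ S, p < q → q < s → s < t →
      p % k = s % k → q % k = t % k → p % k = q % k)
    (a b : ℕ) (hab : ∀ j ∈ S, a ≤ j ∧ j ≤ b) :
    k * S.card + a ≤ k * (S.image (· % k)).card + b := by
  induction hcard : S.card using Nat.strong_induction_on generalizing S a b with
  | _ N ih =>
  subst hcard
  have ihsub : ∀ U ⊂ S, U.Nonempty → ∀ a b : ℕ, (∀ j ∈ U, a ≤ j ∧ j ≤ b) →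
      k * U.card + a ≤ k * (U.image (· % k)).card + b := fun U hU hne a b h =>
    ih U.card (Finset.card_lt_card hU) U hne
      (fun p hp q hq s hs t ht =>
        hnc p (hU.1 hp) q (hU.1 hq) s (hU.1 hs) t (hU.1 ht)) a b h rfl
  obtain ⟨m, hm, hmin⟩ : ∃ m ∈ S, ∀ j ∈ S, m ≤ j :=
    ⟨S.min' hS, S.min'_mem hS, fun j hj => S.min'_le j hj⟩
  have ham := (hab m hm).1
  have hmb := (hab m hm).2
  by_cases hC : (S.filter fun j => m < j ∧ j % k = m % k).Nonempty
  · obtain ⟨c, hc, hcmin⟩ : ∃ c ∈ S.filter (fun j => m < j ∧ j % k = m % k),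
        ∀ j ∈ S.filter (fun j => m < j ∧ j % k = m % k), c ≤ j :=
      ⟨_, Finset.min'_mem _ hC, fun j hj => Finset.min'_le _ j hj⟩
    simp only [Finset.mem_filter] at hc hcmin
    obtain ⟨hcS, hmc, hcm⟩ := hc
    have hnext : ∀ j ∈ S, m < j → j < c → j % k ≠ m % k := fun j hj h1 h2 h3 =>
      absurd (hcmin j ⟨hj, h1, h3⟩) (by omega)
    set U := S.filter (fun j => m < j ∧ j < c) with hU
    set V := S.filter (fun j => c ≤ j) with hV
    have hmU : m ∉ U := by simp [hU]
    have hmV : m ∉ V := by simp [hV, hmc]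
    have hsplit : S = insert m (U ∪ V) := by
      ext j
      simp only [hU, hV, Finset.mem_insert, Finset.mem_union, Finset.mem_filter]
      constructor
      · intro hj
        have := hmin j hj
        by_cases h : j = m
        · exact Or.inl h
        · by_cases h' : c ≤ j
          · exact Or.inr (Or.inr ⟨hj, h'⟩)
          · exact Or.inr (Or.inl ⟨hj, by omega, by omega⟩)
      · rintro (rfl | h | h)
        exacts [hm, h.1, h.1]
    have hUV : Disjoint U V := by
      rw [Finset.disjoint_left]
      intro j h1 h2
      simp only [hU, hV, Finset.mem_filter] at h1 h2
      omega
    have hcardS : S.card = U.card + V.card + 1 := by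
      rw [← Finset.card_union_of_disjoint hUV, ← Finset.card_insert_of_notMem
        (a := m) (s := U ∪ V) (by simp only [Finset.mem_union]; tauto), ← hsplit]
    have himg : Disjoint (U.image (· % k)) (V.image (· % k)) := by
      rw [Finset.disjoint_left]
      intro l h1 h2
      obtain ⟨q, hq, rfl⟩ := Finset.mem_image.1 h1
      obtain ⟨t, ht, htq⟩ := Finset.mem_image.1 h2
      simp only [hU, hV, Finset.mem_filter] at hq ht
      have hqm := hnext q hq.1 hq.2.1 hq.2.2
      have hct : c ≠ t := by
        rintro rfl
        exact hqm (htq.symm.trans hcm)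
      exact hqm (hnc m hm q hq.1 c hcS t ht.1 hq.2.1 hq.2.2 (by omega) hcm.symm htq.symm).symm
    have hle : (U.image (· % k)).card + (V.image (· % k)).card ≤ (S.image (· % k)).card := by
      rw [← Finset.card_union_of_disjoint himg, ← Finset.image_union]
      exact Finset.card_le_card (Finset.image_subset_image (hsplit ▸ Finset.subset_insert _ _))
    have hUS : U ⊂ S := (Finset.ssubset_iff_of_subset (Finset.filter_subset _ _)).2 ⟨m, hm, hmU⟩
    have hVS : V ⊂ S := (Finset.ssubset_iff_of_subset (Finset.filter_subset _ _)).2 ⟨m, hm, hmV⟩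
    have h2 := ihsub V hVS ⟨c, by simp [hV, hcS]⟩ c b fun j hj => by
      simp only [hV, Finset.mem_filter] at hj
      exact ⟨hj.2, (hab j hj.1).2⟩
    obtain ⟨d, hd⟩ : k ∣ c - m := (Nat.modEq_iff_dvd' hmc.le).1 hcm.symm
    have h1 : k * U.card + k ≤ k * (U.image (· % k)).card + (c - m) := by
      rcases U.eq_empty_or_nonempty with h | h
      · have : k ≤ c - m := Nat.le_of_dvd (by omega) ⟨d, hd⟩
        simp [h, this]
      · have h1 := ihsub U hUS h (m + 1) (c - 1) fun j hj => by
          simp only [hU, Finset.mem_filter] at hj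
          omega
        have h3 : k * U.card < k * ((U.image (· % k)).card + d) := by
          rw [mul_add, ← hd]
          omega
        have h4 := Nat.mul_le_mul_left k (Nat.succ_le_of_lt (lt_of_mul_lt_mul_left' h3))
        rw [hd, ← mul_add]
        simpa [Nat.succ_eq_add_one, mul_add] using h4
    have h3 := Nat.mul_le_mul_left k hle
    rw [hcardS]
    simp only [mul_add, mul_one] at h3 ⊢
    omega
  · have huniq : ∀ j ∈ S, j ≠ m → j % k ≠ m % k := fun j hj hne h =>
      hC ⟨j, Finset.mem_filter.2 ⟨hj, lt_of_le_of_ne (hmin j hj) hne.symm, h⟩⟩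
    have hcardS := Finset.card_erase_add_one hm
    have hcardI : (S.image (· % k)).card = ((S.erase m).image (· % k)).card + 1 := by
      conv_lhs => rw [← Finset.insert_erase hm]
      rw [Finset.image_insert, Finset.card_insert_of_notMem]
      intro h
      obtain ⟨j, hj, hjm⟩ := Finset.mem_image.1 h
      exact huniq j (Finset.mem_of_mem_erase hj) (Finset.ne_of_mem_erase hj) hjm
    rw [hcardI, ← hcardS]
    rcases (S.erase m).eq_empty_or_nonempty with h | h
    · simp only [h, Finset.image_empty, Finset.card_empty]
      omega
    · have := ihsub _ (Finset.erase_ssubset hm) h a b fun j hj =>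
        hab j (Finset.mem_of_mem_erase hj)
      simp only [mul_add]
      omega

/-- Twice the signed area of the triangle with vertices at angles `α`, `β`, `γ` on the
unit circle. -/
noncomputable def circleOrient (α β γ : ℝ) : ℝ :=
  (Real.cos β - Real.cos α) * (Real.sin γ - Real.sin α) -
    (Real.cos γ - Real.cos α) * (Real.sin β - Real.sin α)

theorem circleOrient_pos {α β γ : ℝ} (h₁ : α < β) (h₂ : β < γ) (h₃ : γ < α + 2 * Real.pi) :
    0 < circleOrient α β γ := by
  have key : circleOrient α β γ =
      4 * Real.sin ((β - α) / 2) * Real.sin ((γ - β) / 2) * Real.sin ((γ - α) / 2) := by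
    unfold circleOrient
    rw [Real.cos_sub_cos, Real.cos_sub_cos, Real.sin_sub_sin, Real.sin_sub_sin]
    have hs : Real.sin ((γ - β) / 2) = Real.sin ((γ + α) / 2) * Real.cos ((β + α) / 2) -
        Real.cos ((γ + α) / 2) * Real.sin ((β + α) / 2) := by
      rw [← Real.sin_sub]
      congr 1
      ring
    rw [hs]
    ring
  rw [key]
  have s₁ : 0 < Real.sin ((β - α) / 2) :=
    Real.sin_pos_of_pos_of_lt_pi (by linarith) (by linarith)
  have s₂ : 0 < Real.sin ((γ - β) / 2) :=
    Real.sin_pos_of_pos_of_lt_pi (by linarith) (by linarith)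
  have s₃ : 0 < Real.sin ((γ - α) / 2) :=
    Real.sin_pos_of_pos_of_lt_pi (by linarith) (by linarith)
  positivity

/-- Crossing chords of a circle meet, so convex sets containing their endpoints do too. -/
theorem not_disjoint_of_crossing_chords (o : ℝ × ℝ) (r : ℝ) {α β γ δ : ℝ}
    (h₁ : α < β) (h₂ : β < γ) (h₃ : γ < δ) (h₄ : δ < α + 2 * Real.pi) {P Q : Set (ℝ × ℝ)}
    (hP : Convex ℝ P) (hQ : Convex ℝ Q)
    (hα : o + r • (Real.cos α, Real.sin α) ∈ P) (hγ : o + r • (Real.cos γ, Real.sin γ) ∈ P)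
    (hβ : o + r • (Real.cos β, Real.sin β) ∈ Q) (hδ : o + r • (Real.cos δ, Real.sin δ) ∈ Q) :
    ¬ Disjoint P Q := by
  have pA := circleOrient_pos h₂ h₃ (by linarith)
  have pC := circleOrient_pos h₁ (h₂.trans h₃) h₄
  have pB := circleOrient_pos (h₁.trans h₂) h₃ h₄
  have pD := circleOrient_pos h₁ h₂ (by linarith)
  have hsum : circleOrient α γ δ + circleOrient α β γ =
      circleOrient β γ δ + circleOrient α β δ := by
    unfold circleOrient
    ring
  have hne : circleOrient β γ δ + circleOrient α β δ ≠ 0 := by positivity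
  have mP := hP hα hγ (a := circleOrient β γ δ / (circleOrient β γ δ + circleOrient α β δ))
    (b := circleOrient α β δ / (circleOrient β γ δ + circleOrient α β δ))
    (by positivity) (by positivity) (by field_simp)
  have mQ := hQ hβ hδ (a := circleOrient α γ δ / (circleOrient β γ δ + circleOrient α β δ))
    (b := circleOrient α β γ / (circleOrient β γ δ + circleOrient α β δ))
    (by positivity) (by positivity) (by rw [← add_div, hsum, div_self hne])
  refine Set.not_disjoint_iff.2 ⟨_, mP, ?_⟩
  convert mQ using 1
  ext <;> simp only [Prod.fst_add, Prod.snd_add, Prod.smul_fst, Prod.smul_snd, smul_eq_mul] <;>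
    field_simp <;> unfold circleOrient <;> ring


/-- Case A of the Appendix Theorem: `n = k²` points in cyclic order on a circle,
labeled cyclically with `j mod k`; if `T₀, …, T_{k−1}` are pairwise disjoint
convex sets and each `A i` consists of points with label `i` lying in `T i`,
then the total number of selected points is less than `2k`. -/
theorem case_A_bound (k : ℕ) (hk : 1 ≤ k) (n : ℕ) (hn : n = k * k)
    (o : ℝ × ℝ) (r : ℝ) (hr : 0 < r)
    (x : Fin n → ℝ × ℝ) (hinj : Function.Injective x)
    (θ : Fin n → ℝ) (hmono : StrictMono θ)
    (hwrap : ∀ j : Fin n, θ j < θ ⟨0, by rw [hn]; exact Nat.mul_pos (by omega) (by omega)⟩ + 2 * Real.pi)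
    (hx : ∀ j : Fin n, x j = o + r • (Real.cos (θ j), Real.sin (θ j)))
    (T : Fin k → Set (ℝ × ℝ))
    (hconv : ∀ i, Convex ℝ (T i))
    (hdisj : Pairwise (Function.onFun Disjoint T))
    (A : Fin k → Finset (ℝ × ℝ))
    (hA : ∀ i, ↑(A i) ⊆ {p : ℝ × ℝ | ∃ j : Fin n, j.val % k = i.val ∧ p = x j} ∩ T i) :
    ∑ i, (A i).card < 2 * k := by
  classical
  set S : Finset (Fin n) := Finset.univ.filter fun j => x j ∈ A ⟨j.val % k, Nat.mod_lt _ hk⟩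
    with hS
  have hle : ∑ i, (A i).card ≤ S.card := by
    rw [Finset.card_eq_sum_card_fiberwise
      (f := fun j : Fin n => (⟨j.val % k, Nat.mod_lt _ hk⟩ : Fin k)) (t := Finset.univ)
      (fun _ _ => Finset.mem_coe.2 (Finset.mem_univ _))]
    refine Finset.sum_le_sum fun i _ => ?_
    refine (Finset.card_le_card ?_).trans (Finset.card_image_le (f := x))
    intro p hp
    obtain ⟨⟨j, hj, rfl⟩, -⟩ := hA i hp
    have hji : (⟨j.val % k, Nat.mod_lt _ hk⟩ : Fin k) = i := Fin.ext hj
    refine Finset.mem_image.2 ⟨j, ?_, rfl⟩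
    simp only [hS, Finset.mem_filter, Finset.mem_univ, true_and]
    exact ⟨hji ▸ hp, hji⟩
  have hT : ∀ j ∈ S, x j ∈ T ⟨j.val % k, Nat.mod_lt _ hk⟩ := fun j hj =>
    (hA _ (Finset.mem_filter.1 hj).2).2
  refine hle.trans_lt ?_
  rcases S.eq_empty_or_nonempty with h | h
  · rw [h, Finset.card_empty]
    omega
  have key := mul_card_add_le_of_noncrossing k (S.map Fin.valEmbedding) (h.map) ?_ 0 (n - 1) ?_
  · rw [Finset.card_map] at key
    have hm : ((S.map Fin.valEmbedding).image (· % k)).card ≤ k := by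
      refine (Finset.card_le_card (t := Finset.range k) fun l hl => ?_).trans_eq
        (Finset.card_range k)
      obtain ⟨j, -, rfl⟩ := Finset.mem_image.1 hl
      exact Finset.mem_range.2 (Nat.mod_lt _ hk)
    have hm' := Nat.mul_le_mul_left k hm
    have hpos : 0 < k * k := Nat.mul_pos hk hk
    refine Nat.lt_of_mul_lt_mul_left (a := k) ?_
    have : k * (2 * k) = k * k + k * k := by ring
    omega
  · simp only [Finset.mem_map, Fin.valEmbedding_apply]
    rintro _ ⟨p, hp, rfl⟩ _ ⟨q, hq, rfl⟩ _ ⟨s, hs, rfl⟩ _ ⟨t, ht, rfl⟩ hpq hqs hst hps hqt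
    by_contra hne
    have tp := hT p hp
    have tq := hT q hq
    have ts := hT s hs
    have tt := hT t ht
    simp only [← hps, ← hqt] at ts tt
    rw [hx] at tp tq ts tt
    have hp0 := hmono.monotone (show ⟨0, by omega⟩ ≤ p from Nat.zero_le _)
    exact not_disjoint_of_crossing_chords o r (hmono hpq) (hmono hqs) (hmono hst)
      ((hwrap t).trans_le (by gcongr)) (hconv _) (hconv _) tp ts tq tt
      (hdisj fun h => hne (congrArg Fin.val h))
  · simp only [Finset.mem_map, Fin.valEmbedding_apply]
    rintro _ ⟨j, -, rfl⟩
    omega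
end

section
/- Let k ≥ 2 and n = k². Let x₀, x₁, …, x_{n−1} be n distinct points in cyclic order on a circle Γ ⊆ ℝ² with center o and radius r > 0, and label the point x_j with j mod k. Let T ⊆ ℝ² be the convex hull of three points (a triangle). Let T₀, …, T_{k−2} be pairwise disjoint convex subsets of ℝ², for each i ∈ {0,…,k−2} let A_i ⊆ { x_j : j ≡ i (mod k) } ∩ T_i ∩ T, and let A_{k−1} ⊆ { x_j : j ≡ k−1 (mod k) } \ T. Then |A₀| + |A₁| + ⋯ + |A_{k−1}| ≤ 2k + 1. -/
/-- The number of consecutive pairs of a list that satisfy `R`. -/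
def countSteps {α : Type*} (R : α → α → Prop) [DecidableRel R] : List α → ℕ
  | a :: b :: l => (if R a b then 1 else 0) + countSteps R (b :: l)
  | _ => 0

theorem length_le_countSteps {α : Type*} [LinearOrder α] (l : List α) :
    l.length ≤ countSteps (· < ·) l + countSteps (· ≥ ·) l + 1 := by
  induction l with
  | nil => simp
  | cons a l ih =>
    cases l with
    | nil => simp
    | cons b l =>
      simp only [countSteps, List.length_cons] at ih ⊢
      rcases lt_or_ge a b with h | h
      · simp only [h, not_le.2 h, ge_iff_le, if_true, if_false] at ih ⊢; omega
      · simp only [h, not_lt.2 h, ge_iff_le, if_true, if_false] at ih ⊢; omega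

theorem countSteps_gt_pop {α : Type*} [LinearOrder α] (a v : α) (pre suf : List α) :
    countSteps (· > ·) (v :: suf) + (if v < a then 1 else 0) ≤
      countSteps (· > ·) (a :: (pre ++ v :: suf)) := by
  induction pre generalizing a with
  | nil => simp [countSteps]; omega
  | cons b pre ih =>
    have := ih b
    simp only [List.cons_append, countSteps] at this ⊢
    split_ifs at this ⊢ <;> first | omega | (exfalso; order)

theorem exists_stack {α : Type*} [LinearOrder α] (a : α) (l : List α)
    (hl : ∀ u v, u ≠ v → ¬ List.Sublist [u, v, u, v] (a :: l)) :
    ∃ st : List α, List.Sublist (a :: st) (a :: l) ∧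
      (∀ v ∈ a :: l, v ∉ a :: st → ∃ u, u ≠ v ∧ List.Sublist [u, v, u] (a :: l)) ∧
      countSteps (· < ·) (a :: l) + countSteps (· > ·) (a :: st) + 1 ≤
        (a :: l).toFinset.card := by
  induction l generalizing a with
  | nil => exact ⟨[], by simp [countSteps]⟩
  | cons b l ih =>
    obtain ⟨st, hst, hclosed, hcard⟩ :=
      ih b fun u v huv h => hl u v huv (h.trans (List.sublist_cons_self _ _))
    by_cases ha : a ∈ b :: l
    · have hmem : a ∈ b :: st := by
        by_contra hn
        obtain ⟨u, hu, hs⟩ := hclosed a ha hn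
        exact hl a u hu.symm (hs.cons_cons a)
      have hcard' : (a :: b :: l).toFinset.card = (b :: l).toFinset.card := by
        rw [List.toFinset_cons, Finset.insert_eq_of_mem (by simpa using ha)]
      obtain ⟨pre, suf, hps⟩ := List.append_of_mem hmem
      have hsub : List.Sublist (pre ++ a :: suf) (b :: l) := hps ▸ hst
      refine ⟨suf, ?_, ?_, ?_⟩
      · exact (((List.sublist_cons_self a suf).trans (List.sublist_append_right _ _)).trans
          hsub).cons_cons a
      · intro v hv hvn
        have hva : v ≠ a := fun h => hvn (by simp [h])
        have hv' : v ∈ b :: l := by simpa [hva] using hv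
        by_cases hvs : v ∈ b :: st
        · rw [hps] at hvs
          have hpre : v ∈ pre := by
            rcases List.mem_append.1 hvs with h | h
            · exact h
            · exact absurd h hvn
          refine ⟨a, hva.symm, List.Sublist.cons_cons a (List.Sublist.trans ?_ hsub)⟩
          exact (List.singleton_sublist.2 hpre).append
            (List.singleton_sublist.2 (List.mem_cons_self (a := a) (l := suf)))
        · obtain ⟨u, hu, hs⟩ := hclosed v hv' hvs
          exact ⟨u, hu, hs.trans (List.sublist_cons_self _ _)⟩
      · rw [hcard']
        have key : countSteps (· > ·) (a :: suf) + (if a < b then 1 else 0) ≤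
            countSteps (· > ·) (b :: st) := by
          cases pre with
          | nil =>
            obtain ⟨rfl, rfl⟩ : b = a ∧ st = suf := by simpa using hps
            simp
          | cons c pre =>
            obtain ⟨rfl, rfl⟩ : b = c ∧ st = pre ++ a :: suf := by simpa using hps
            exact countSteps_gt_pop _ _ _ _
        simp only [countSteps] at hcard ⊢
        omega
    · refine ⟨b :: st, hst.cons_cons a, ?_, ?_⟩
      · intro v hv hvn
        have hva : v ≠ a := fun h => hvn (by simp [h])
        obtain ⟨u, hu, hs⟩ := hclosed v (by simpa [hva] using hv)
          (fun h => hvn (List.mem_cons_of_mem _ h))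
        exact ⟨u, hu, hs.trans (List.sublist_cons_self _ _)⟩
      · have hcard' : (a :: b :: l).toFinset.card = (b :: l).toFinset.card + 1 := by
          rw [List.toFinset_cons, Finset.card_insert_of_notMem (by simpa using ha)]
        have hab : a ≠ b := fun h => ha (by simp [h])
        rw [hcard']
        simp only [countSteps] at hcard ⊢
        rcases lt_or_gt_of_ne hab with h | h
        · simp only [h, if_true, gt_iff_lt, not_lt.2 h.le, if_false] at hcard ⊢; omega
        · simp only [h, if_true, gt_iff_lt, not_lt.2 h.le, if_false] at hcard ⊢; omega

theorem countSteps_ge_add_div_le {n k K : ℕ} (g : Fin n → ℕ)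
    (hg : ∀ i j, g j ≤ g i → (j : ℕ) % k ≤ i % k) (a : Fin n) (l : List (Fin n))
    (hl : (a :: l).Pairwise (· < ·)) (hK : ∀ j ∈ a :: l, (j : ℕ) / k ≤ K) :
    countSteps (· ≥ ·) ((a :: l).map g) + (a : ℕ) / k ≤ K := by
  induction l generalizing a with
  | nil => simpa [countSteps] using hK
  | cons b l ih =>
    have h1 := ih b hl.of_cons fun j hj => hK j (List.mem_cons_of_mem _ hj)
    have hab : a < b := List.rel_of_pairwise_cons hl List.mem_cons_self
    have hdiv : (a : ℕ) / k ≤ b / k := Nat.div_le_div_right hab.le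
    simp only [List.map_cons, countSteps] at h1 ⊢
    split_ifs with h
    · have h2 := hg a b h
      have h3 : (a : ℕ) / k < b / k := by
        refine lt_of_le_of_ne hdiv fun h => ?_
        have ea := Nat.div_add_mod (a : ℕ) k
        have eb := Nat.div_add_mod (b : ℕ) k
        rw [h] at ea
        omega
      omega
    · omega

theorem card_le_of_noncrossing {n k K B : ℕ} (S : Finset (Fin n)) (g : Fin n → ℕ)
    (hg : ∀ i j, g j ≤ g i → (j : ℕ) % k ≤ i % k) (hK : ∀ j ∈ S, (j : ℕ) / k ≤ K)
    (hB : ∀ j ∈ S, g j < B)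
    (hS : ∀ a ∈ S, ∀ b ∈ S, ∀ c ∈ S, ∀ d ∈ S, a < b → b < c → c < d →
      g a = g c → g b = g d → g a = g b) :
    S.card ≤ K + B := by
  have hlen := S.length_sort (· ≤ ·)
  have hmem : ∀ j, j ∈ S.sort (· ≤ ·) ↔ j ∈ S := fun j => S.mem_sort (· ≤ ·)
  have hsorted : (S.sort (· ≤ ·)).Pairwise (· < ·) := (S.sortedLT_sort).pairwise
  generalize S.sort (· ≤ ·) = l at hlen hmem hsorted
  cases l with
  | nil => simp at hlen; omega
  | cons a l =>
    have hnc : ∀ u v, u ≠ v → ¬ List.Sublist [u, v, u, v] (g a :: l.map g) := by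
      intro u v huv h
      rw [← List.map_cons, List.sublist_map_iff] at h
      obtain ⟨l', hl', he⟩ := h
      obtain ⟨p, q, s, t, rfl⟩ := List.length_eq_four.1 (by
        simpa using (congrArg List.length he).symm)
      simp only [List.map_cons, List.map_nil, List.cons.injEq, and_true] at he
      obtain ⟨rfl, rfl, h1, h2⟩ := he
      have hp := hsorted.sublist hl'
      have hm : ∀ j ∈ [p, q, s, t], j ∈ S := fun j hj => (hmem j).1 (hl'.subset hj)
      simp at hp hm
      exact huv (hS p hm.1 q hm.2.1 s hm.2.2.1 t hm.2.2.2 hp.1.1 hp.2.1.1 hp.2.2 h1 h2)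
    obtain ⟨st, -, -, hcard⟩ := exists_stack (g a) (l.map g) hnc
    have hle : (g a :: l.map g).toFinset.card ≤ B := by
      rw [← Finset.card_range B]
      refine Finset.card_le_card fun u hu => ?_
      rw [← List.map_cons, List.mem_toFinset, List.mem_map] at hu
      obtain ⟨j, hj, rfl⟩ := hu
      exact Finset.mem_range.2 (hB j ((hmem j).1 hj))
    have hge := countSteps_ge_add_div_le g hg a l hsorted fun j hj => hK j ((hmem j).1 hj)
    have hlen' := length_le_countSteps ((a :: l).map g)
    simp only [List.map_cons, List.length_cons, List.length_map] at *
    generalize (a : ℕ) / k = q at *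
    omega

/-- Twice the signed area of the triangle `p q s`. -/
def signedArea (p q s : ℝ × ℝ) : ℝ :=
  (q.1 - p.1) * (s.2 - p.2) - (q.2 - p.2) * (s.1 - p.1)

open Real in
theorem signedArea_circle_pos (o : ℝ × ℝ) {r α β γ : ℝ} (hr : 0 < r) (h₁ : α < β) (h₂ : β < γ)
    (h₃ : γ < α + 2 * π) :
    0 < signedArea (o + r • (cos α, sin α)) (o + r • (cos β, sin β)) (o + r • (cos γ, sin γ)) := by
  have key : signedArea (o + r • (cos α, sin α)) (o + r • (cos β, sin β))
      (o + r • (cos γ, sin γ)) =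
      4 * r ^ 2 * (sin ((β - α) / 2) * sin ((γ - β) / 2) * sin ((γ - α) / 2)) := by
    obtain ⟨u, rfl⟩ : ∃ u, β = α + 2 * u := ⟨(β - α) / 2, by ring⟩
    obtain ⟨v, rfl⟩ : ∃ v, γ = α + 2 * u + 2 * v := ⟨(γ - (α + 2 * u)) / 2, by ring⟩
    rw [show (α + 2 * u - α) / 2 = u by ring, show (α + 2 * u + 2 * v - (α + 2 * u)) / 2 = v by ring,
      show (α + 2 * u + 2 * v - α) / 2 = u + v by ring]
    have ha := sin_sq_add_cos_sq α
    have hu := sin_sq_add_cos_sq u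
    have hv := sin_sq_add_cos_sq v
    simp only [signedArea, Prod.fst_add, Prod.snd_add, Prod.smul_fst, Prod.smul_snd, smul_eq_mul,
      cos_add, sin_add, cos_two_mul, sin_two_mul]
    grind
  rw [key]
  have := sin_pos_of_pos_of_lt_pi (x := (β - α) / 2) (by linarith) (by linarith)
  have := sin_pos_of_pos_of_lt_pi (x := (γ - β) / 2) (by linarith) (by linarith)
  have := sin_pos_of_pos_of_lt_pi (x := (γ - α) / 2) (by linarith) (by linarith)
  positivity

theorem segment_inter_segment_nonempty {p₁ p₂ p₃ p₄ : ℝ × ℝ}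
    (h₁ : 0 < signedArea p₂ p₃ p₄) (h₂ : 0 < signedArea p₁ p₃ p₄)
    (h₃ : 0 < signedArea p₁ p₂ p₄) (h₄ : 0 < signedArea p₁ p₂ p₃) :
    (segment ℝ p₁ p₃ ∩ segment ℝ p₂ p₄).Nonempty := by
  have hsum : signedArea p₂ p₃ p₄ + signedArea p₁ p₂ p₄ =
      signedArea p₁ p₃ p₄ + signedArea p₁ p₂ p₃ := by
    simp only [signedArea]; ring
  have hpos := add_pos h₁ h₃
  refine ⟨_, mem_segment_iff_div.2 ⟨_, _, h₁.le, h₃.le, hpos, rfl⟩,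
    mem_segment_iff_div.2 ⟨_, _, h₂.le, h₄.le, add_pos h₂ h₄, ?_⟩⟩
  rw [← hsum]
  ext
  · simp only [Prod.fst_add, Prod.smul_fst, smul_eq_mul]
    field_simp
    simp only [signedArea]; ring
  · simp only [Prod.snd_add, Prod.smul_snd, smul_eq_mul]
    field_simp
    simp only [signedArea]; ring

theorem mem_convexHull_triple {a b c p : ℝ × ℝ} :
    p ∈ convexHull ℝ {a, b, c} ↔
      ∃ α β γ : ℝ, 0 ≤ α ∧ 0 ≤ β ∧ 0 ≤ γ ∧ α + β + γ = 1 ∧ α • a + β • b + γ • c = p := by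
  constructor
  · rw [convexHull_insert (Set.insert_nonempty _ _), convexHull_pair, mem_convexJoin]
    rintro ⟨_, rfl, q, ⟨s, t, hs, ht, hst, rfl⟩, ⟨u, v, hu, hv, huv, rfl⟩⟩
    refine ⟨u, v * s, v * t, hu, by positivity, by positivity, ?_, ?_⟩
    · rw [add_assoc, ← mul_add, hst, mul_one, huv]
    · rw [smul_add, smul_smul, smul_smul, add_assoc]
  · rintro ⟨α, β, γ, hα, hβ, hγ, h, rfl⟩
    have := (convex_convexHull ℝ {a, b, c}).sum_mem (t := Finset.univ) (w := ![α, β, γ])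
      (z := ![a, b, c]) (by simp [Fin.forall_fin_succ, *]) (by simpa [Fin.sum_univ_three] using h)
      (by
        intro i _
        apply subset_convexHull
        fin_cases i <;> simp)
    simpa [Fin.sum_univ_three] using this

theorem signedArea_convexCombination {a b c : ℝ × ℝ} {u v : ℝ × ℝ} {α β γ : ℝ}
    (h : α + β + γ = 1) :
    signedArea u v (α • a + β • b + γ • c) =
      α * signedArea u v a + β * signedArea u v b + γ * signedArea u v c := by
  obtain rfl : α = 1 - β - γ := by linarith
  simp [signedArea]; ring

theorem signedArea_eq_zero_of_mem_convexHull {a b c p q s : ℝ × ℝ} (h : signedArea a b c = 0)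
    (hp : p ∈ convexHull ℝ {a, b, c}) (hq : q ∈ convexHull ℝ {a, b, c})
    (hs : s ∈ convexHull ℝ {a, b, c}) : signedArea p q s = 0 := by
  obtain ⟨α, β, γ, -, -, -, e, rfl⟩ := mem_convexHull_triple.1 hp
  obtain ⟨α', β', γ', -, -, -, e', rfl⟩ := mem_convexHull_triple.1 hq
  obtain ⟨α'', β'', γ'', -, -, -, e'', rfl⟩ := mem_convexHull_triple.1 hs
  obtain rfl : α = 1 - β - γ := by linarith
  obtain rfl : α' = 1 - β' - γ' := by linarith
  obtain rfl : α'' = 1 - β'' - γ'' := by linarith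
  simp only [signedArea, Prod.fst_add, Prod.snd_add, Prod.smul_fst, Prod.smul_snd,
    smul_eq_mul] at h ⊢
  linear_combination ((β' - β) * (γ'' - γ) - (γ' - γ) * (β'' - β)) * h

theorem convex_signedArea (u v : ℝ × ℝ) (m : ℝ) :
    Convex ℝ {p | m * signedArea u v p < 0} ∧ Convex ℝ {p | 0 ≤ m * signedArea u v p} := by
  have key : ∀ (s t : ℝ) (p q : ℝ × ℝ), s + t = 1 → m * signedArea u v (s • p + t • q) =
      s * (m * signedArea u v p) + t * (m * signedArea u v q) := by
    intro s t p q h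
    obtain rfl : s = 1 - t := by linarith
    simp [signedArea]; ring
  constructor
  · intro p hp q hq s t hs ht hst
    rw [Set.mem_ofPred_eq, key s t p q hst]
    exact (convex_Iio (0 : ℝ)) hp hq hs ht hst
  · intro p hp q hq s t hs ht hst
    rw [Set.mem_ofPred_eq, key s t p q hst]
    exact (convex_Ici (0 : ℝ)) hp hq hs ht hst

theorem convexHull_triple_eq {a b c : ℝ × ℝ} (h : signedArea a b c ≠ 0) :
    convexHull ℝ {a, b, c} = {p | 0 ≤ signedArea a b c * signedArea b c p ∧
      0 ≤ signedArea a b c * signedArea c a p ∧ 0 ≤ signedArea a b c * signedArea a b p} := by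
  ext p
  have hD : 0 < signedArea a b c ^ 2 := by positivity
  constructor
  · intro hp
    obtain ⟨α, β, γ, hα, hβ, hγ, e, rfl⟩ := mem_convexHull_triple.1 hp
    have h0 : ∀ u v : ℝ × ℝ, signedArea u v u = 0 ∧ signedArea u v v = 0 := fun u v => by
      constructor <;> simp only [signedArea] <;> ring
    have h1 : signedArea b c a = signedArea a b c := by simp only [signedArea]; ring
    have h2 : signedArea c a b = signedArea a b c := by simp only [signedArea]; ring
    simp only [Set.mem_ofPred_eq, signedArea_convexCombination e, h0, h1, h2, mul_zero, add_zero,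
      zero_add]
    refine ⟨?_, ?_, ?_⟩ <;> rw [mul_left_comm] <;>
      exact mul_nonneg ‹_› (mul_self_nonneg _)
  · rintro ⟨h1, h2, h3⟩
    have hsum : signedArea b c p + signedArea c a p + signedArea a b p = signedArea a b c := by
      simp only [signedArea]; ring
    refine mem_convexHull_triple.2 ⟨_, _, _, div_nonneg h1 hD.le, div_nonneg h2 hD.le,
      div_nonneg h3 hD.le, ?_, ?_⟩
    · rw [← add_div, ← add_div, ← mul_add, ← mul_add, hsum, ← sq, div_self hD.ne']
    · ext
      · simp only [Prod.fst_add, Prod.smul_fst, smul_eq_mul]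
        field_simp
        simp only [signedArea]; ring
      · simp only [Prod.snd_add, Prod.smul_snd, smul_eq_mul]
        field_simp
        simp only [signedArea]; ring

theorem card_le_of_convex {n k K B : ℕ} (o : ℝ × ℝ) {r : ℝ} (hr : 0 < r) (θ : Fin n → ℝ)
    (hmono : StrictMono θ) (hwrap : ∀ i j, θ j < θ i + 2 * Real.pi)
    (C : ℕ → Set (ℝ × ℝ)) (hC : ∀ u, Convex ℝ (C u)) (hdisj : Pairwise (Function.onFun Disjoint C))
    (S : Finset (Fin n)) (g : Fin n → ℕ)
    (hg : ∀ i j, g j ≤ g i → (j : ℕ) % k ≤ i % k) (hK : ∀ j ∈ S, (j : ℕ) / k ≤ K)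
    (hB : ∀ j ∈ S, g j < B)
    (hS : ∀ j ∈ S, o + r • (Real.cos (θ j), Real.sin (θ j)) ∈ C (g j)) :
    S.card ≤ K + B := by
  refine card_le_of_noncrossing S g hg hK hB ?_
  intro p hp q hq s hs t ht hpq hqs hst h₁ h₂
  by_contra hne
  have hpos : ∀ i j l, i < j → j < l → 0 < signedArea (o + r • (Real.cos (θ i), Real.sin (θ i)))
      (o + r • (Real.cos (θ j), Real.sin (θ j))) (o + r • (Real.cos (θ l), Real.sin (θ l))) :=
    fun i j l hij hjl => signedArea_circle_pos o hr (hmono hij) (hmono hjl) (hwrap i l)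
  obtain ⟨z, hz₁, hz₂⟩ := segment_inter_segment_nonempty (hpos q s t hqs hst)
    (hpos p s t (hpq.trans hqs) hst) (hpos p q t hpq (hqs.trans hst)) (hpos p q s hpq hqs)
  exact Set.disjoint_left.1 (hdisj hne) ((hC _).segment_subset (hS p hp) (h₁ ▸ hS s hs) hz₁)
    ((hC _).segment_subset (hS q hq) (h₂ ▸ hS t ht) hz₂)

theorem card_le_two_of_mem_convexHull {n : ℕ} (o : ℝ × ℝ) {r : ℝ} (hr : 0 < r) (θ : Fin n → ℝ)
    (hmono : StrictMono θ) (hwrap : ∀ i j, θ j < θ i + 2 * Real.pi) {a b c : ℝ × ℝ}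
    (h : signedArea a b c = 0) (S : Finset (Fin n))
    (hS : ∀ j ∈ S, o + r • (Real.cos (θ j), Real.sin (θ j)) ∈ convexHull ℝ {a, b, c}) :
    S.card ≤ 2 := by
  by_contra! hlt
  let e := S.orderEmbOfFin rfl
  have he : ∀ i, e i ∈ S := S.orderEmbOfFin_mem rfl
  have h₁ : e ⟨0, by omega⟩ < e ⟨1, by omega⟩ := e.strictMono (by simp)
  have h₂ : e ⟨1, by omega⟩ < e ⟨2, by omega⟩ := e.strictMono (by simp)
  exact (signedArea_circle_pos o hr (hmono h₁) (hmono h₂) (hwrap _ _)).ne'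
    (signedArea_eq_zero_of_mem_convexHull h (hS _ (he _)) (hS _ (he _)) (hS _ (he _)))

theorem card_le_of_forall_mod_eq {n k : ℕ} (hn : n = k * k) (i : ℕ) (S : Finset (Fin n))
    (hS : ∀ j ∈ S, (j : ℕ) % k = i) : S.card ≤ k := by
  have := Finset.card_le_card_of_injOn (s := S) (t := Finset.range k) (fun j => (j : ℕ) / k)
    (fun j _ => Finset.mem_coe.2 (Finset.mem_range.2 (Nat.div_lt_of_lt_mul (hn ▸ j.2))))
    (fun p hp q hq h => by
      have hp' := Nat.div_add_mod (p : ℕ) k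
      have hq' := Nat.div_add_mod (q : ℕ) k
      rw [hS p hp, show (p : ℕ) / k = q / k from h] at hp'
      rw [hS q hq] at hq'
      exact Fin.ext (hp'.symm.trans hq'))
  simpa using this

theorem sum_card_le_card_filter {α : Type*} [DecidableEq α] {n k : ℕ} (hk : 0 < k) (x : Fin n → α)
    (A : Fin k → Finset α) (hA : ∀ i, ∀ p ∈ A i, ∃ j : Fin n, (j : ℕ) % k = i ∧ p = x j) :
    ∑ i, (A i).card ≤
      (Finset.univ.filter fun j : Fin n => x j ∈ A ⟨j % k, Nat.mod_lt _ hk⟩).card := by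
  rw [Finset.card_eq_sum_card_fiberwise (t := Finset.univ)
    (f := fun j : Fin n => (⟨j % k, Nat.mod_lt _ hk⟩ : Fin k)) (by simp [Set.MapsTo])]
  refine Finset.sum_le_sum fun i _ => ?_
  refine (Finset.card_le_card fun p hp => ?_).trans (Finset.card_image_le (f := x))
  obtain ⟨j, hj, rfl⟩ := hA i p hp
  have hji : (⟨j % k, Nat.mod_lt _ hk⟩ : Fin k) = i := Fin.ext hj
  exact Finset.mem_image_of_mem x (by simp [hji, hp])


/-- Case B of the Appendix Theorem: `n = k²` points in cyclic order on a circle,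
labeled cyclically with `j mod k`; `T` is a triangle, `T₀, …, T_{k−2}` are
pairwise disjoint convex sets, each `A i` (for `i < k−1`) consists of points
with label `i` lying in `T' i ∩ T`, and `A (k−1)` consists of points with label
`k−1` lying outside `T`. Then the total number of selected points is at most
`2k + 1`. -/
theorem case_B_bound (k : ℕ) (hk : 2 ≤ k) (n : ℕ) (hn : n = k * k)
    (o : ℝ × ℝ) (r : ℝ) (hr : 0 < r)
    (x : Fin n → ℝ × ℝ) (hinj : Function.Injective x)
    (θ : Fin n → ℝ) (hmono : StrictMono θ)
    (hwrap : ∀ j : Fin n, θ j < θ ⟨0, by rw [hn]; exact Nat.mul_pos (by omega) (by omega)⟩ + 2 * Real.pi)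
    (hx : ∀ j : Fin n, x j = o + r • (Real.cos (θ j), Real.sin (θ j)))
    (a b c : ℝ × ℝ) (T : Set (ℝ × ℝ)) (hT : T = convexHull ℝ {a, b, c})
    (T' : Fin (k - 1) → Set (ℝ × ℝ))
    (hconv : ∀ i, Convex ℝ (T' i))
    (hdisj : Pairwise (Function.onFun Disjoint T'))
    (A : Fin k → Finset (ℝ × ℝ))
    (hA : ∀ i : Fin k, ∀ h : i.val < k - 1,
      ↑(A i) ⊆ ({p : ℝ × ℝ | ∃ j : Fin n, j.val % k = i.val ∧ p = x j}
        ∩ T' ⟨i.val, h⟩) ∩ T)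
    (hAlast : ↑(A ⟨k - 1, by omega⟩) ⊆
      {p : ℝ × ℝ | ∃ j : Fin n, j.val % k = k - 1 ∧ p = x j} \ T) :
    ∑ i, (A i).card ≤ 2 * k + 1 := by
  have hk0 : 0 < k := by omega
  have hwrap' : ∀ i j, θ j < θ i + 2 * Real.pi := fun i j =>
    (hwrap j).trans_le (by gcongr; exact hmono.monotone (Nat.zero_le _))
  have hlabel : ∀ i, ∀ p ∈ A i, ∃ j : Fin n, (j : ℕ) % k = i ∧ p = x j := by
    intro i p hp
    by_cases hi : i.val < k - 1
    · exact (hA i hi hp).1.1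
    · have he : i = ⟨k - 1, by omega⟩ := Fin.ext (by simp; omega)
      rw [he] at hp ⊢
      exact (hAlast hp).1
  refine (sum_card_le_card_filter hk0 x A hlabel).trans ?_
  set S := Finset.univ.filter fun j : Fin n => x j ∈ A ⟨j % k, Nat.mod_lt _ hk0⟩
  have hin : ∀ j ∈ S, ∀ h : (j : ℕ) % k < k - 1, x j ∈ T' ⟨j % k, h⟩ ∧ x j ∈ T := by
    intro j hj h
    have := hA ⟨j % k, Nat.mod_lt _ hk0⟩ h (Finset.mem_filter.1 hj).2
    exact ⟨this.1.2, this.2⟩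
  have hout : ∀ j ∈ S, ¬ (j : ℕ) % k < k - 1 → x j ∉ T := by
    intro j hj h
    have hlt := Nat.mod_lt (j : ℕ) hk0
    have he : (⟨j % k, hlt⟩ : Fin k) = ⟨k - 1, by omega⟩ := Fin.ext (by simp; omega)
    have hm := (Finset.mem_filter.1 hj).2
    rw [he] at hm
    exact (hAlast hm).2
  by_cases hD : signedArea a b c = 0
  · have h₁ : (S.filter fun j : Fin n => (j : ℕ) % k < k - 1).card ≤ 2 :=
      card_le_two_of_mem_convexHull o hr θ hmono hwrap' hD _ fun j hj => by
        rw [Finset.mem_filter] at hj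
        rw [← hx, ← hT]
        exact (hin j hj.1 hj.2).2
    have h₂ : (S.filter fun j : Fin n => ¬ (j : ℕ) % k < k - 1).card ≤ k :=
      card_le_of_forall_mod_eq hn (k - 1) _ fun j hj => by
        have := (Finset.mem_filter.1 hj).2
        have := Nat.mod_lt (j : ℕ) hk0
        omega
    have := Finset.card_filter_add_card_filter_not (s := S) fun j : Fin n => (j : ℕ) % k < k - 1
    omega
  · have hTeq := hT.trans (convexHull_triple_eq hD)
    have hTconv : Convex ℝ T := hT ▸ convex_convexHull ℝ _
    set D := signedArea a b c
    set C : ℕ → Set (ℝ × ℝ) := fun u =>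
      if h : u < k - 1 then T' ⟨u, h⟩ ∩ T
      else if u = k - 1 then {p | D * signedArea b c p < 0}
      else if u = k then {p | 0 ≤ D * signedArea b c p} ∩ {p | D * signedArea c a p < 0}
      else if u = k + 1 then {p | 0 ≤ D * signedArea b c p} ∩ {p | 0 ≤ D * signedArea c a p} ∩
        {p | D * signedArea a b p < 0}
      else ∅ with hCdef
    set g : Fin n → ℕ := fun j =>
      if (j : ℕ) % k < k - 1 then j % k
      else if D * signedArea b c (x j) < 0 then k - 1
      else if D * signedArea c a (x j) < 0 then k
      else k + 1 with hgdef
    have hCconv : ∀ u, Convex ℝ (C u) := by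
      intro u
      simp only [hCdef]
      split_ifs
      · exact (hconv _).inter hTconv
      · exact (convex_signedArea _ _ _).1
      · exact (convex_signedArea _ _ _).2.inter (convex_signedArea _ _ _).1
      · exact ((convex_signedArea _ _ _).2.inter (convex_signedArea _ _ _).2).inter
          (convex_signedArea _ _ _).1
      · exact convex_empty
    have hCdisj : Pairwise (Function.onFun Disjoint C) := by
      refine (pairwise_disjoint_on C).2 fun u v huv => Set.disjoint_left.2 fun p hu hv => ?_
      simp only [hCdef] at hu hv
      by_cases hv' : v < k - 1
      · rw [dif_pos (huv.trans hv')] at hu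
        rw [dif_pos hv'] at hv
        exact Set.disjoint_left.1 (hdisj fun h => huv.ne (Fin.mk.inj_iff.1 h)) hu.1 hv.1
      · rw [dif_neg hv'] at hv
        rw [hTeq] at hu
        split_ifs at hu hv <;> first
          | omega
          | exact hv.elim
          | simp only [Set.mem_inter_iff, Set.mem_ofPred_eq] at hu hv
            grind
    have hbound := card_le_of_convex (k := k) (K := k - 1) (B := k + 2) o hr θ hmono hwrap' C
      hCconv hCdisj S g ?_ ?_ ?_ ?_
    · omega
    · intro i j hij
      have := Nat.mod_lt (i : ℕ) hk0
      have := Nat.mod_lt (j : ℕ) hk0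
      simp only [hgdef] at hij
      split_ifs at hij <;> omega
    · intro j _
      exact Nat.le_sub_one_of_lt (Nat.div_lt_of_lt_mul (hn ▸ j.2))
    · intro j _
      simp only [hgdef]
      split_ifs <;> omega
    · intro j hj
      rw [← hx]
      by_cases h : (j : ℕ) % k < k - 1
      · simp only [hgdef, hCdef, if_pos h, dif_pos h]
        exact hin j hj h
      · have hnot := hout j hj h
        rw [hTeq] at hnot
        simp only [hgdef, if_neg h]
        split_ifs with h₁ h₂
        · simpa [hCdef] using h₁
        · have e₁ : ¬ k < k - 1 := by omega
          have e₂ : k ≠ k - 1 := by omega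
          simpa [hCdef, e₁, e₂] using ⟨not_lt.1 h₁, h₂⟩
        · have e₁ : ¬ k + 1 < k - 1 := by omega
          have e₂ : k + 1 ≠ k - 1 := by omega
          have h₃ : D * signedArea a b (x j) < 0 := by
            by_contra h₃
            exact hnot ⟨not_lt.1 h₁, not_lt.1 h₂, not_lt.1 h₃⟩
          simpa [hCdef, e₁, e₂] using ⟨⟨not_lt.1 h₁, not_lt.1 h₂⟩, h₃⟩
end

section
/- Let Γ ⊆ ℝ² be a circle (the set of points at distance r > 0 from a center o ∈ ℝ²) and let T ⊆ ℝ² be the convex hull of three points. Then the set Γ \ T has at most 3 connected components. -/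
/-- A coordinate description of membership in a circle in the plane. -/
theorem mem_sphere_iff_sq_add_sq {o x : EuclideanSpace ℝ (Fin 2)} {r : ℝ} (hr : 0 ≤ r) :
    x ∈ Metric.sphere o r ↔ (x 0 - o 0) ^ 2 + (x 1 - o 1) ^ 2 = r ^ 2 := by
  rw [Metric.mem_sphere, EuclideanSpace.dist_eq, Real.sqrt_eq_iff_eq_sq (by positivity) hr,
    Fin.sum_univ_two, Real.dist_eq, Real.dist_eq, sq_abs, sq_abs]

/-- Polar coordinates in the plane. -/
theorem exists_polar_coordinates (u v : ℝ) :
    ∃ ρ φ : ℝ, 0 ≤ ρ ∧ u = ρ * Real.cos φ ∧ v = ρ * Real.sin φ :=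
  ⟨‖(⟨u, v⟩ : ℂ)‖, Complex.arg ⟨u, v⟩, norm_nonneg _,
    (Complex.norm_mul_cos_arg ⟨u, v⟩).symm, (Complex.norm_mul_sin_arg ⟨u, v⟩).symm⟩

theorem ordConnected_setOf_mul_cos_lt {k : ℝ} (hk : 0 ≤ k) (d : ℝ) :
    (Set.Icc 0 (2 * Real.pi) ∩ {θ | k * Real.cos θ < d}).OrdConnected := by
  refine ⟨fun x hx y hy z hz => ⟨⟨hx.1.1.trans hz.1, hz.2.trans hy.1.2⟩, ?_⟩⟩
  rcases le_total z Real.pi with h | h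
  · exact (mul_le_mul_of_nonneg_left
      (Real.cos_le_cos_of_nonneg_of_le_pi hx.1.1 h hz.1) hk).trans_lt hx.2
  · refine (mul_le_mul_of_nonneg_left ?_ hk).trans_lt hy.2
    rw [← Real.cos_two_pi_sub z, ← Real.cos_two_pi_sub y]
    exact Real.cos_le_cos_of_nonneg_of_le_pi (by linarith [hy.1.2]) (by linarith)
      (by linarith [hz.2])

/-- A circle meets an open half-plane in a preconnected set. -/
theorem isPreconnected_sphere_inter_halfPlane (o : EuclideanSpace ℝ (Fin 2)) {r : ℝ} (hr : 0 < r)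
    (α β γ : ℝ) : IsPreconnected (Metric.sphere o r ∩ {x | α * x 0 + β * x 1 < γ}) := by
  obtain ⟨ρ, φ, hρ, rfl, rfl⟩ := exists_polar_coordinates α β
  have key := (ordConnected_setOf_mul_cos_lt (mul_nonneg hr.le hρ)
    (γ - (ρ * Real.cos φ * o 0 + ρ * Real.sin φ * o 1))).isPreconnected
  have value (θ : ℝ) : ρ * Real.cos φ * (o 0 + r * Real.cos (φ + θ)) +
      ρ * Real.sin φ * (o 1 + r * Real.sin (φ + θ)) =
      r * ρ * Real.cos θ + (ρ * Real.cos φ * o 0 + ρ * Real.sin φ * o 1) := by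
    rw [Real.cos_add, Real.sin_add]
    linear_combination r * ρ * Real.cos θ * Real.cos_sq_add_sin_sq φ
  convert key.image
    (fun θ => (!₂[o 0 + r * Real.cos (φ + θ), o 1 + r * Real.sin (φ + θ)] :
      EuclideanSpace ℝ (Fin 2))) (by fun_prop) using 1
  ext x
  constructor
  · rintro ⟨hx, hlt⟩
    rw [mem_sphere_iff_sq_add_sq hr.le] at hx
    obtain ⟨s, t, hs, h0, h1⟩ := exists_polar_coordinates (x 0 - o 0) (x 1 - o 1)
    have hsr : s = r := by
      rw [h0, h1] at hx
      refine (sq_eq_sq₀ hs hr.le).1 ?_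
      linear_combination hx - s ^ 2 * Real.cos_sq_add_sin_sq t
    subst hsr
    have hmem := toIcoMod_mem_Ico Real.two_pi_pos 0 (t - φ)
    have hθ : φ + toIcoMod Real.two_pi_pos 0 (t - φ) =
        t - toIcoDiv Real.two_pi_pos 0 (t - φ) * (2 * Real.pi) := by
      rw [toIcoMod, zsmul_eq_mul]
      ring
    set θ := toIcoMod Real.two_pi_pos 0 (t - φ)
    have hc : x 0 = o 0 + s * Real.cos (φ + θ) := by
      rw [hθ, Real.cos_sub_int_mul_two_pi]
      linarith
    have hd : x 1 = o 1 + s * Real.sin (φ + θ) := by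
      rw [hθ, Real.sin_sub_int_mul_two_pi]
      linarith
    refine ⟨θ, ⟨⟨hmem.1, by linarith [hmem.2]⟩, ?_⟩, ?_⟩
    · have := value θ
      rw [← hc, ← hd] at this
      simp only [Set.mem_ofPred_eq] at hlt ⊢
      linarith
    · ext i
      fin_cases i
      · simpa using hc.symm
      · simpa using hd.symm
  · rintro ⟨θ, ⟨-, hθ⟩, rfl⟩
    refine ⟨(mem_sphere_iff_sq_add_sq hr.le).2 ?_, ?_⟩
    · simp only [Matrix.cons_val_zero, Matrix.cons_val_one]
      linear_combination r ^ 2 * Real.cos_sq_add_sin_sq (φ + θ)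
    · simp only [Set.mem_ofPred_eq, Matrix.cons_val_zero,
        Matrix.cons_val_one] at hθ ⊢
      linarith [value θ]

/-- A space covered by a family of preconnected sets has at most as many components as there are
members of the family. -/
theorem exists_injective_connectedComponents {X ι : Type*} [TopologicalSpace X] (S : ι → Set X)
    (hS : ∀ i, IsPreconnected (S i)) (hcover : ∀ x, ∃ i, x ∈ S i) :
    ∃ g : ConnectedComponents X → ι, Function.Injective g := by
  choose f hf using hcover
  choose s hs using ConnectedComponents.surjective_coe (α := X)
  refine ⟨fun C => f (s C), fun C D h => ?_⟩
  rw [← hs C, ← hs D, ConnectedComponents.coe_eq_coe']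
  refine (hS (f (s C))).subset_connectedComponent ?_ (hf _)
  have := hf (s D)
  rwa [← show f (s C) = f (s D) from h] at this

theorem convex_halfPlane_le (α β γ : ℝ) :
    Convex ℝ {x : EuclideanSpace ℝ (Fin 2) | γ ≤ α * x 0 + β * x 1} := by
  intro x hx y hy s t hs ht hst
  simp only [Set.mem_ofPred_eq, PiLp.add_apply, PiLp.smul_apply, smul_eq_mul] at *
  have h1 := mul_le_mul_of_nonneg_left hx hs
  have h2 := mul_le_mul_of_nonneg_left hy ht
  have h3 : γ = s * γ + t * γ := by rw [← add_mul, hst, one_mul]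
  linarith

/-- An affine inequality which holds at three points holds on their convex hull. -/
theorem le_of_mem_convexHull_triple {a b c x : EuclideanSpace ℝ (Fin 2)}
    (hx : x ∈ convexHull ℝ {a, b, c}) {α β γ : ℝ} (ha : γ ≤ α * a 0 + β * a 1)
    (hb : γ ≤ α * b 0 + β * b 1) (hc : γ ≤ α * c 0 + β * c 1) :
    γ ≤ α * x 0 + β * x 1 := by
  refine convexHull_min ?_ (convex_halfPlane_le α β γ) hx
  rintro y (rfl | rfl | rfl) <;> assumption

theorem mem_convexHull_triple_of_weights {a b c x : EuclideanSpace ℝ (Fin 2)} {u v w : ℝ}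
    (hu : 0 ≤ u) (hv : 0 ≤ v) (hw : 0 ≤ w) (h : u + v + w = 1)
    (h0 : x 0 = u * a 0 + v * b 0 + w * c 0) (h1 : x 1 = u * a 1 + v * b 1 + w * c 1) :
    x ∈ convexHull ℝ {a, b, c} := by
  have hx : x = ∑ i, ![u, v, w] i • ![a, b, c] i := by
    ext i
    fin_cases i <;> simp [Fin.sum_univ_three, h0, h1]
  rw [hx]
  refine (convex_convexHull ℝ _).sum_mem ?_ ?_ ?_
  · intro i _
    fin_cases i <;> simpa
  · simpa [Fin.sum_univ_three] using h
  · intro i _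
    fin_cases i <;> exact subset_convexHull ℝ _ (by simp)

/-- The signed area (doubled) of a triangle in the plane. -/
def planeDet (a b c : EuclideanSpace ℝ (Fin 2)) : ℝ :=
  (b 0 - a 0) * (c 1 - a 1) - (b 1 - a 1) * (c 0 - a 0)

/-- A nondegenerate triangle is cut out by the three half-planes bounded by its sides. -/
theorem notMem_triangle_iff {a b c : EuclideanSpace ℝ (Fin 2)} (hD : planeDet a b c ≠ 0)
    (x : EuclideanSpace ℝ (Fin 2)) :
    x ∉ convexHull ℝ {a, b, c} ↔ planeDet a b c * planeDet b c x < 0 ∨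
      planeDet a b c * planeDet c a x < 0 ∨ planeDet a b c * planeDet a b x < 0 := by
  have hpos : 0 < planeDet a b c ^ 2 := by positivity
  have side (p q : EuclideanSpace ℝ (Fin 2)) (ha : 0 ≤ planeDet a b c * planeDet p q a)
      (hb : 0 ≤ planeDet a b c * planeDet p q b) (hc : 0 ≤ planeDet a b c * planeDet p q c)
      (hx : x ∈ convexHull ℝ {a, b, c}) : 0 ≤ planeDet a b c * planeDet p q x := by
    have expand (y : EuclideanSpace ℝ (Fin 2)) : planeDet a b c * planeDet p q y =
        (-planeDet a b c * (q 1 - p 1)) * y 0 + (planeDet a b c * (q 0 - p 0)) * y 1 -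
          planeDet a b c * ((q 0 - p 0) * p 1 - (q 1 - p 1) * p 0) := by
      simp only [planeDet]
      ring
    rw [expand, sub_nonneg] at *
    exact le_of_mem_convexHull_triple hx ha hb hc
  rw [← not_iff_not, not_not]
  push Not
  constructor
  · intro hx
    refine ⟨side b c ?_ ?_ ?_ hx, side c a ?_ ?_ ?_ hx, side a b ?_ ?_ ?_ hx⟩ <;>
      simp only [planeDet] at hpos ⊢ <;> ring_nf at hpos ⊢ <;> linarith
  · rintro ⟨h1, h2, h3⟩
    refine mem_convexHull_triple_of_weights (div_nonneg h1 hpos.le) (div_nonneg h2 hpos.le)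
      (div_nonneg h3 hpos.le) ?_ ?_ ?_ <;> field_simp <;> simp only [planeDet] <;> ring

/-- The vertices of a degenerate triangle lie on a common line. -/
theorem exists_line_of_planeDet_eq_zero {a b c : EuclideanSpace ℝ (Fin 2)}
    (hD : planeDet a b c = 0) :
    ∃ α β γ : ℝ, 0 < α ^ 2 + β ^ 2 ∧ α * a 0 + β * a 1 = γ ∧ α * b 0 + β * b 1 = γ ∧
      α * c 0 + β * c 1 = γ := by
  have normal (α β : ℝ) (h : α ≠ 0 ∨ β ≠ 0) : 0 < α ^ 2 + β ^ 2 := by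
    rcases h with h | h <;> positivity
  unfold planeDet at hD
  by_cases hb : -(b 1 - a 1) ≠ 0 ∨ b 0 - a 0 ≠ 0
  · exact ⟨_, _, _, normal _ _ hb, rfl, by ring, by linear_combination hD⟩
  push Not at hb
  by_cases hc : -(c 1 - a 1) ≠ 0 ∨ c 0 - a 0 ≠ 0
  · exact ⟨_, _, _, normal _ _ hc, rfl, by linear_combination -hD, by ring⟩
  push Not at hc
  exact ⟨1, 0, a 0, by norm_num, by ring, by linarith, by linarith⟩

/-- A line meets a circle in at most two points. -/
theorem eq_or_eq_of_mem_line_of_mem_sphere {o p q x : EuclideanSpace ℝ (Fin 2)} {r : ℝ}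
    (hr : 0 ≤ r) {α β γ : ℝ} (hn : 0 < α ^ 2 + β ^ 2) (hpq : p ≠ q)
    (hp : p ∈ Metric.sphere o r) (hq : q ∈ Metric.sphere o r) (hx : x ∈ Metric.sphere o r)
    (hp' : α * p 0 + β * p 1 = γ) (hq' : α * q 0 + β * q 1 = γ)
    (hx' : α * x 0 + β * x 1 = γ) : x = p ∨ x = q := by
  rw [mem_sphere_iff_sq_add_sq hr] at hp hq hx
  have param (y : EuclideanSpace ℝ (Fin 2)) (hy : α * y 0 + β * y 1 = γ) :
      ∃ s : ℝ, y 0 = x 0 - s * β ∧ y 1 = x 1 + s * α := by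
    refine ⟨(α * (y 1 - x 1) - β * (y 0 - x 0)) / (α ^ 2 + β ^ 2), ?_, ?_⟩ <;> field_simp
    · linear_combination α * (hy - hx')
    · linear_combination β * (hy - hx')
  obtain ⟨s, hs0, hs1⟩ := param p hp'
  obtain ⟨t, ht0, ht1⟩ := param q hq'
  rw [hs0, hs1] at hp
  rw [ht0, ht1] at hq
  have hst : s ≠ t := by
    rintro rfl
    apply hpq
    ext i
    fin_cases i
    · exact hs0.trans ht0.symm
    · exact hs1.trans ht1.symm
  have hprod : s * t * ((s - t) * (α ^ 2 + β ^ 2)) = 0 := by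
    linear_combination t * (hp - hx) - s * (hq - hx)
  have hzero : s = 0 ∨ t = 0 :=
    mul_eq_zero.1 ((mul_eq_zero.1 hprod).resolve_right
      (mul_ne_zero (sub_ne_zero.2 hst) hn.ne'))
  rcases hzero with rfl | rfl
  · left
    ext i
    fin_cases i
    · simpa using hs0.symm
    · simpa using hs1.symm
  · right
    ext i
    fin_cases i
    · simpa using ht0.symm
    · simpa using ht1.symm

/-- The open half-plane bounded by the tangent at a point of a circle contains every other point
of the circle. -/
theorem tangent_halfPlane_iff {o p x : EuclideanSpace ℝ (Fin 2)} {r : ℝ} (hr : 0 ≤ r)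
    (hp : p ∈ Metric.sphere o r) (hx : x ∈ Metric.sphere o r) :
    (p 0 - o 0) * x 0 + (p 1 - o 1) * x 1 < (p 0 - o 0) * p 0 + (p 1 - o 1) * p 1 ↔ x ≠ p := by
  rw [mem_sphere_iff_sq_add_sq hr] at hp hx
  have gap : (p 0 - o 0) * p 0 + (p 1 - o 1) * p 1 - ((p 0 - o 0) * x 0 + (p 1 - o 1) * x 1) =
      ((x 0 - p 0) ^ 2 + (x 1 - p 1) ^ 2) / 2 := by
    linear_combination (hp - hx) / 2
  constructor
  · rintro h rfl
    exact lt_irrefl _ h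
  · intro h
    rw [← sub_pos, gap]
    by_contra hle
    apply h
    ext i
    fin_cases i
    · exact sub_eq_zero.1 (pow_eq_zero_iff two_ne_zero |>.1
        (by linarith [sq_nonneg (x 0 - p 0), sq_nonneg (x 1 - p 1)] :
          (x 0 - p 0) ^ 2 = 0))
    · exact sub_eq_zero.1 (pow_eq_zero_iff two_ne_zero |>.1
        (by linarith [sq_nonneg (x 0 - p 0), sq_nonneg (x 1 - p 1)] :
          (x 1 - p 1) ^ 2 = 0))

/-- On a circle, the complement of a possibly degenerate triangle is the union of three open
half-planes. -/
theorem exists_halfPlanes_of_triangle (o : EuclideanSpace ℝ (Fin 2)) {r : ℝ} (hr : 0 ≤ r)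
    (a b c : EuclideanSpace ℝ (Fin 2)) :
    ∃ α β γ : Fin 3 → ℝ, ∀ x ∈ Metric.sphere o r,
      x ∉ convexHull ℝ {a, b, c} ↔ ∃ i, α i * x 0 + β i * x 1 < γ i := by
  by_cases hD : planeDet a b c = 0
  · obtain ⟨α, β, γ, hn, ha, hb, hc⟩ := exists_line_of_planeDet_eq_zero hD
    have line {x} (hx : x ∈ convexHull ℝ {a, b, c}) : α * x 0 + β * x 1 = γ := by
      have h1 := le_of_mem_convexHull_triple hx ha.ge hb.ge hc.ge
      have h2 := le_of_mem_convexHull_triple (α := -α) (β := -β) (γ := -γ) hx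
        (by linarith) (by linarith) (by linarith)
      linarith
    by_cases hp : ∃ p ∈ Metric.sphere o r, p ∈ convexHull ℝ {a, b, c}
    · obtain ⟨p, hp, hpT⟩ := hp
      by_cases hq : ∃ q ∈ Metric.sphere o r, q ∈ convexHull ℝ {a, b, c} ∧ p ≠ q
      · obtain ⟨q, hq, hqT, hpq⟩ := hq
        refine ⟨![α, -α, 0], ![β, -β, 0], ![γ, -γ, 0], fun x hx => ?_⟩
        have hxT : x ∈ convexHull ℝ {a, b, c} ↔ α * x 0 + β * x 1 = γ := by
          refine ⟨line, fun h => ?_⟩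
          rcases eq_or_eq_of_mem_line_of_mem_sphere hr hn hpq hp hq hx (line hpT) (line hqT) h
            with rfl | rfl <;> assumption
        rw [hxT, ← ne_eq, ne_iff_lt_or_gt, Fin.exists_fin_succ, Fin.exists_fin_two]
        simp only [Matrix.cons_val_zero, Matrix.cons_val_succ, Matrix.cons_val_one,
          zero_mul, add_zero, lt_irrefl, or_false]
        refine or_congr_right ⟨fun h => by linarith, fun h => by linarith⟩
      · push Not at hq
        refine ⟨fun _ => p 0 - o 0, fun _ => p 1 - o 1,
          fun _ => (p 0 - o 0) * p 0 + (p 1 - o 1) * p 1, fun x hx => ?_⟩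
        rw [exists_const, tangent_halfPlane_iff hr hp hx, not_iff_not]
        exact ⟨fun h => (hq x hx h).symm, fun h => h ▸ hpT⟩
    · push Not at hp
      exact ⟨0, 0, 1, fun x hx => iff_of_true (hp x hx) ⟨0, by simp⟩⟩
  · let D := planeDet a b c
    refine ⟨![D * (b 1 - c 1), D * (c 1 - a 1), D * (a 1 - b 1)],
      ![D * (c 0 - b 0), D * (a 0 - c 0), D * (b 0 - a 0)],
      ![D * ((b 1 - c 1) * b 0 + (c 0 - b 0) * b 1),
        D * ((c 1 - a 1) * c 0 + (a 0 - c 0) * c 1),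
        D * ((a 1 - b 1) * a 0 + (b 0 - a 0) * a 1)], fun x _ => ?_⟩
    have expand (p q : EuclideanSpace ℝ (Fin 2)) : D * planeDet p q x < 0 ↔
        D * (p 1 - q 1) * x 0 + D * (q 0 - p 0) * x 1 <
          D * ((p 1 - q 1) * p 0 + (q 0 - p 0) * p 1) := by
      rw [← sub_neg (b := D * ((p 1 - q 1) * p 0 + (q 0 - p 0) * p 1))]
      refine iff_of_eq (congrArg (· < 0) ?_)
      rw [planeDet]
      ring
    rw [notMem_triangle_iff hD, Fin.exists_fin_succ, Fin.exists_fin_two]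
    exact or_congr (expand b c) (or_congr (expand c a) (expand a b))

/-- Removing a geometric triangle from a circle leaves at most three connected
components. -/
theorem circle_minus_triangle_components
    (o : EuclideanSpace ℝ (Fin 2)) (r : ℝ) (hr : 0 < r)
    (Γ : Set (EuclideanSpace ℝ (Fin 2))) (hΓ : Γ = Metric.sphere o r)
    (a b c : EuclideanSpace ℝ (Fin 2))
    (T : Set (EuclideanSpace ℝ (Fin 2))) (hT : T = convexHull ℝ {a, b, c}) :
    ∃ g : ConnectedComponents ↥(Γ \ T) → Fin 3, Function.Injective g := by
  subst hΓ hT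
  obtain ⟨α, β, γ, h⟩ := exists_halfPlanes_of_triangle o hr.le a b c
  refine exists_injective_connectedComponents
    (fun i => {x | α i * x.1 0 + β i * x.1 1 < γ i}) (fun i => ?_)
    (fun x => (h x x.2.1).1 x.2.2)
  rw [← Topology.IsInducing.subtypeVal.isPreconnected_image]
  convert isPreconnected_sphere_inter_halfPlane o hr (α i) (β i) (γ i) using 1
  ext x
  constructor
  · rintro ⟨y, hy, rfl⟩
    exact ⟨y.2.1, hy⟩
  · rintro ⟨hx, hlt⟩
    exact ⟨⟨x, hx, (h x hx).2 ⟨i, hlt⟩⟩, hlt, rfl⟩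
end
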